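/- arXiv:1902.00713 — 4 statements merged into one kernel-verified Lean document; each statement's English description precedes it below -/
import Mathlib

section
/- Let K be a field, m ≥ 1, and n₁,…,n_m positive integers. Let A = K[X_{i,j} : 1 ≤ i ≤ m, 1 ≤ j ≤ nᵢ] be the polynomial ring over K in these variables, and with the convention X_{k,0} := 1 define, for each 1 ≤ a ≤ N := n₁ + ⋯ + n_m, the polynomial Q_a := Σ X_{1,i₁}·X_{2,i₂}·⋯·X_{m,i_m}, the sum over all tuples (i₁,…,i_m) with 0 ≤ i_k ≤ n_k for each k and i₁ + ⋯ + i_m = a. Then Q₁, Q₂,…, Q_N is an A-regular sequence. -/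
open MvPolynomial

/-- A sequence (given as a list) `a₁, …, aₙ` in a commutative ring `A` is `A`-regular if for
each `i`, `aᵢ` is not a zero divisor on `A ⧸ (a₁, …, a_{i-1})`. -/
def IsRegularSeq {A : Type*} [CommRing A] (l : List A) : Prop :=
  ∀ (i : ℕ) (h : i < l.length), ∀ x : A,
    l.get ⟨i, h⟩ * x ∈ Ideal.span {y | y ∈ l.take i} →
      x ∈ Ideal.span {y | y ∈ l.take i}

/-- The variable `X_{k,j}` of `A = K[X_{i,j} : 1 ≤ i ≤ m, 1 ≤ j ≤ nᵢ]`, with the convention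
`X_{k,0} = 1` (and `0` out of range). -/
noncomputable def Xc (K : Type*) [CommRing K] (m : ℕ) (n : Fin m → ℕ) (k : Fin m) (j : ℕ) :
    MvPolynomial (Σ i : Fin m, Fin (n i)) K :=
  if h : 1 ≤ j ∧ j ≤ n k then X ⟨k, ⟨j - 1, by omega⟩⟩
  else if j = 0 then 1 else 0

/-- `Q_a := Σ X_{1,i₁} ⋯ X_{m,i_m}`, the sum over all tuples `(i₁,…,i_m)` with
`0 ≤ i_k ≤ n_k` and `i₁ + ⋯ + i_m = a`. -/
noncomputable def Qpoly (K : Type*) [CommRing K] (m : ℕ) (n : Fin m → ℕ) (a : ℕ) :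
    MvPolynomial (Σ i : Fin m, Fin (n i)) K :=
  ∑ t ∈ (Fintype.piFinset fun k : Fin m => Finset.range (n k + 1)).filter
      (fun t => ∑ k, t k = a),
    ∏ k, Xc K m n k (t k)


lemma RingHom.FaithfullyFlat.comp {A B C : Type*} [CommRing A] [CommRing B] [CommRing C]
    {f : A →+* B} {g : B →+* C} (hf : f.FaithfullyFlat) (hg : g.FaithfullyFlat) :
    (g.comp f).FaithfullyFlat := by
  algebraize [f, g, g.comp f]
  rw [← algebraMap_toAlgebra (g.comp f), faithfullyFlat_algebraMap_iff]
  exact .trans A B C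

section CoeffHom

open Polynomial (freeMonic)

/-- The `R`-algebra map from `R[y₀, …, yₙ₋₁]` sending `yᵢ` to the `i`-th coefficient of `p`. -/
noncomputable def coeffHom (R : Type*) {S : Type*} [CommRing R] [CommRing S] [Algebra R S]
    (n : ℕ) (p : Polynomial S) : MvPolynomial (Fin n) R →ₐ[R] S :=
  aeval fun i => p.coeff i

variable {R S T : Type*} [CommRing R] [CommRing S] [CommRing T] [Algebra R S] {n : ℕ}

lemma map_coeffHom_freeMonic {p : Polynomial S} (hp : p.Monic) (hn : p.natDegree = n) :
    (freeMonic R n).map (coeffHom R n p : MvPolynomial (Fin n) R →+* S) = p := by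
  ext i
  rw [Polynomial.coeff_map, Polynomial.coeff_freeMonic]
  split_ifs with h h'
  · simp [coeffHom]
  · simp [h', ← hn, hp.leadingCoeff]
  · simp [Polynomial.coeff_eq_zero_of_natDegree_lt (p := p) (n := i) (by lia)]

omit [Algebra R S] in
lemma ringHom_ext_freeMonic {f g : MvPolynomial (Fin n) R →+* S}
    (hC : f.comp C = g.comp C) (h : (freeMonic R n).map f = (freeMonic R n).map g) : f = g := by
  refine MvPolynomial.ringHom_ext (fun r => congr($hC r)) fun i => ?_
  simpa [Polynomial.coeff_freeMonic] using congr(($h).coeff i)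

lemma comp_coeffHom_eq {p : Polynomial S} (hp : p.Monic) (hn : p.natDegree = n)
    (f : S →+* T) (g : MvPolynomial (Fin n) R →+* T)
    (hC : f.comp (algebraMap R S) = g.comp C) (h : p.map f = (freeMonic R n).map g) :
    f.comp (coeffHom R n p : MvPolynomial (Fin n) R →+* S) = g := by
  refine ringHom_ext_freeMonic ?_ ?_
  · rw [← hC]; ext; simp
  · rw [← Polynomial.map_map, map_coeffHom_freeMonic hp hn, h]

end CoeffHom

section SplitRoot

open Polynomial (freeMonic)

variable (R : Type*) [CommRing R] (n : ℕ)

/-- The product of a linear factor with indeterminate root and the generic monic polynomial of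
degree `n`. -/
noncomputable def linearMulFreeMonic : Polynomial (MvPolynomial (Fin n) (Polynomial R)) :=
  (.X - .C (C .X)) * freeMonic (Polynomial R) n

lemma monic_linearMulFreeMonic : (linearMulFreeMonic R n).Monic :=
  (Polynomial.monic_X_sub_C _).mul (Polynomial.monic_freeMonic _ _)

lemma natDegree_linearMulFreeMonic [Nontrivial R] :
    (linearMulFreeMonic R n).natDegree = n + 1 := by
  rw [linearMulFreeMonic, (Polynomial.monic_X_sub_C _).natDegree_mul
    (Polynomial.monic_freeMonic _ _), Polynomial.natDegree_X_sub_C,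
    Polynomial.natDegree_freeMonic, add_comm]

/-- The map of coefficient rings classifying the splitting off of a root from the generic monic
polynomial of degree `n + 1`. -/
noncomputable def splitRoot :
    MvPolynomial (Fin (n + 1)) R →+* MvPolynomial (Fin n) (Polynomial R) :=
  coeffHom R (n + 1) (linearMulFreeMonic R n)

lemma map_splitRoot_freeMonic [Nontrivial R] :
    (freeMonic R (n + 1)).map (splitRoot R n) = linearMulFreeMonic R n :=
  map_coeffHom_freeMonic (monic_linearMulFreeMonic R n) (natDegree_linearMulFreeMonic R n)

/-- The map from the ring adjoining a root of the generic monic polynomial of degree `n + 1`. -/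
noncomputable def adjoinRootToSplit [Nontrivial R] :
    AdjoinRoot (freeMonic R (n + 1)) →+* MvPolynomial (Fin n) (Polynomial R) :=
  AdjoinRoot.lift (splitRoot R n) (C .X) (by
    rw [← Polynomial.eval_map, map_splitRoot_freeMonic]
    simp [linearMulFreeMonic])

/-- The quotient of the generic monic polynomial of degree `n + 1` by the linear factor given by
an adjoined root. -/
noncomputable def freeMonicQuotient : Polynomial (AdjoinRoot (freeMonic R (n + 1))) :=
  (freeMonic R (n + 1)).map (AdjoinRoot.of _) /ₘ (.X - .C (AdjoinRoot.root _))

lemma linear_mul_freeMonicQuotient :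
    (.X - .C (AdjoinRoot.root _)) * freeMonicQuotient R n =
      (freeMonic R (n + 1)).map (AdjoinRoot.of _) := by
  rw [freeMonicQuotient, Polynomial.mul_divByMonic_eq_iff_isRoot, Polynomial.IsRoot,
    Polynomial.eval_map, AdjoinRoot.eval₂_root]

lemma map_freeMonicQuotient [Nontrivial R] :
    (freeMonicQuotient R n).map (adjoinRootToSplit R n) = freeMonic (Polynomial R) n := by
  rw [freeMonicQuotient, Polynomial.map_divByMonic _ (Polynomial.monic_X_sub_C _),
    Polynomial.map_map, adjoinRootToSplit, AdjoinRoot.lift_comp_of, map_splitRoot_freeMonic,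
    linearMulFreeMonic]
  simp [Polynomial.mul_divByMonic_cancel_left _ (Polynomial.monic_X_sub_C _)]

/-- The inverse of `adjoinRootToSplit`, sending the indeterminate root to the adjoined root. -/
noncomputable def splitToAdjoinRoot :
    MvPolynomial (Fin n) (Polynomial R) →+* AdjoinRoot (freeMonic R (n + 1)) :=
  eval₂Hom (Polynomial.eval₂RingHom ((AdjoinRoot.of _).comp C) (AdjoinRoot.root _))
    fun i => (freeMonicQuotient R n).coeff i

lemma nontrivial_adjoinRoot_freeMonic [Nontrivial R] :
    Nontrivial (AdjoinRoot (freeMonic R (n + 1))) :=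
  (adjoinRootToSplit R n).domain_nontrivial

lemma monic_freeMonicQuotient [Nontrivial R] : (freeMonicQuotient R n).Monic := by
  refine (Polynomial.monic_X_sub_C (AdjoinRoot.root _)).of_mul_monic_left ?_
  rw [linear_mul_freeMonicQuotient]
  exact (Polynomial.monic_freeMonic _ _).map _

lemma natDegree_freeMonicQuotient [Nontrivial R] : (freeMonicQuotient R n).natDegree = n := by
  have := nontrivial_adjoinRoot_freeMonic R n
  rw [← (monic_freeMonicQuotient R n).natDegree_map (adjoinRootToSplit R n),
    map_freeMonicQuotient, Polynomial.natDegree_freeMonic]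

lemma map_splitToAdjoinRoot_freeMonic [Nontrivial R] :
    (freeMonic (Polynomial R) n).map (splitToAdjoinRoot R n) = freeMonicQuotient R n := by
  let := (Polynomial.eval₂RingHom ((AdjoinRoot.of _).comp C)
    (AdjoinRoot.root (freeMonic R (n + 1)))).toAlgebra
  exact map_coeffHom_freeMonic (R := Polynomial R) (monic_freeMonicQuotient R n)
    (natDegree_freeMonicQuotient R n)

lemma adjoinRootToSplit_comp [Nontrivial R] :
    (adjoinRootToSplit R n).comp (splitToAdjoinRoot R n) = .id _ := by
  refine ringHom_ext_freeMonic ?_ ?_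
  · ext
    · simp [adjoinRootToSplit, splitToAdjoinRoot, splitRoot, coeffHom]
    · simp [adjoinRootToSplit, splitToAdjoinRoot]
  · rw [← Polynomial.map_map, map_splitToAdjoinRoot_freeMonic, map_freeMonicQuotient,
      Polynomial.map_id]

lemma splitToAdjoinRoot_comp [Nontrivial R] :
    (splitToAdjoinRoot R n).comp (adjoinRootToSplit R n) = .id _ := by
  refine AdjoinRoot.ringHom_ext ?_ ?_
  · rw [RingHom.comp_assoc, adjoinRootToSplit, AdjoinRoot.lift_comp_of, RingHom.id_comp]
    refine comp_coeffHom_eq (monic_linearMulFreeMonic R n) (natDegree_linearMulFreeMonic R n)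
      _ _ ?_ ?_
    · ext r
      change splitToAdjoinRoot R n (C (Polynomial.C r)) = _
      simp [splitToAdjoinRoot]
    · rw [linearMulFreeMonic, Polynomial.map_mul, map_splitToAdjoinRoot_freeMonic,
        ← linear_mul_freeMonicQuotient]
      simp [splitToAdjoinRoot]
  · simp [adjoinRootToSplit, splitToAdjoinRoot]

lemma faithfullyFlat_splitRoot [Nontrivial R] : (splitRoot R n).FaithfullyFlat := by
  have := nontrivial_adjoinRoot_freeMonic R n
  have : Module.Free (MvPolynomial (Fin (n + 1)) R) (AdjoinRoot (freeMonic R (n + 1))) :=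
    (Polynomial.monic_freeMonic R (n + 1)).free_adjoinRoot
  have h : (AdjoinRoot.of (freeMonic R (n + 1))).FaithfullyFlat :=
    RingHom.faithfullyFlat_algebraMap_iff.mpr inferInstance
  let e := RingEquiv.ofRingHom (adjoinRootToSplit R n) (splitToAdjoinRoot R n)
    (adjoinRootToSplit_comp R n) (splitToAdjoinRoot_comp R n)
  have key : splitRoot R n = (adjoinRootToSplit R n).comp (AdjoinRoot.of _) := by
    rw [adjoinRootToSplit, AdjoinRoot.lift_comp_of]
  rw [key]
  exact h.comp (.of_bijective (f := adjoinRootToSplit R n) e.bijective)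

end SplitRoot

section RootsHom

open Polynomial (freeMonic)

/-- The monic polynomial whose roots are the variables `X s`. -/
noncomputable def genericSplit (R σ : Type*) [CommRing R] [Fintype σ] :
    Polynomial (MvPolynomial σ R) :=
  ∏ s : σ, (.X - .C (X s))

/-- The map sending the generic coefficients to the coefficients of `genericSplit R σ`. -/
noncomputable def rootsHom (R σ : Type*) [CommRing R] [Fintype σ] (n : ℕ) :
    MvPolynomial (Fin n) R →ₐ[R] MvPolynomial σ R :=
  coeffHom R n (genericSplit R σ)

variable {R σ τ : Type*} [CommRing R] [Fintype σ] [Fintype τ] {n : ℕ}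

lemma monic_genericSplit : (genericSplit R σ).Monic :=
  Polynomial.monic_prod_of_monic _ _ fun _ _ => Polynomial.monic_X_sub_C _

lemma natDegree_genericSplit [Nontrivial R] :
    (genericSplit R σ).natDegree = Fintype.card σ := by
  rw [genericSplit, Polynomial.natDegree_prod_of_monic _ _
    fun _ _ => Polynomial.monic_X_sub_C _]
  simp

lemma map_rootsHom_freeMonic [Nontrivial R] (hn : Fintype.card σ = n) :
    (freeMonic R n).map (rootsHom R σ n : MvPolynomial (Fin n) R →+* _) = genericSplit R σ :=
  map_coeffHom_freeMonic monic_genericSplit (natDegree_genericSplit.trans hn)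

lemma rename_comp_rootsHom (e : σ ≃ τ) :
    (rename e).comp (rootsHom R σ n) = rootsHom R τ n := by
  ext i : 1
  have h : (genericSplit R σ).map (rename (R := R) e : MvPolynomial σ R →+* _) =
      genericSplit R τ := by
    simp [genericSplit, Polynomial.map_prod, ← e.prod_comp]
  simp [rootsHom, coeffHom, ← h]

lemma rootsHom_option [Nontrivial R] :
    ((optionEquivRight R (Fin n)).symm.toRingEquiv.toRingHom).comp
      ((rootsHom (Polynomial R) (Fin n) n : MvPolynomial (Fin n) (Polynomial R) →+* _).comp
        (splitRoot R n)) =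
    (rootsHom R (Option (Fin n)) (n + 1) :
        MvPolynomial (Fin (n + 1)) R →+* MvPolynomial (Option (Fin n)) R) := by
  have h0 : (optionEquivRight R (Fin n)).symm (C .X) = X none := by
    rw [← optionEquivRight_X_none, AlgEquiv.symm_apply_apply]
  have h1 (i : Fin n) : (optionEquivRight R (Fin n)).symm (X i) = X (some i) := by
    rw [← optionEquivRight_X_some, AlgEquiv.symm_apply_apply]
  have hC (r : R) : (optionEquivRight R (Fin n)).symm (C (.C r)) = C r := by
    rw [← optionEquivRight_C, AlgEquiv.symm_apply_apply]
  refine ringHom_ext_freeMonic ?_ ?_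
  · ext r
    have : splitRoot R n (C r) = C (.C r) := by
      simp [splitRoot]
    have h2 : rootsHom (Polynomial R) (Fin n) n (C (.C r)) = C (.C r) :=
      (rootsHom (Polynomial R) (Fin n) n).commutes _
    simp [this, h2, hC]
  · rw [← Polynomial.map_map, ← Polynomial.map_map, map_splitRoot_freeMonic,
      map_rootsHom_freeMonic (by simp), linearMulFreeMonic, Polynomial.map_mul,
      map_rootsHom_freeMonic (by simp)]
    have h2 : rootsHom (Polynomial R) (Fin n) n (C .X) = C .X :=
      (rootsHom (Polynomial R) (Fin n) n).commutes _
    simp [genericSplit, Polynomial.map_prod, Fintype.prod_option, h0, h1, h2]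

lemma faithfullyFlat_rootsHom_of_equiv (e : σ ≃ τ)
    (h : (rootsHom R σ n : MvPolynomial (Fin n) R →+* MvPolynomial σ R).FaithfullyFlat) :
    (rootsHom R τ n : MvPolynomial (Fin n) R →+* MvPolynomial τ R).FaithfullyFlat := by
  have h' := h.comp (.of_bijective
    (f := (rename e : MvPolynomial σ R →ₐ[R] MvPolynomial τ R).toRingHom)
    (renameEquiv R e).bijective)
  have key := congr(($(rename_comp_rootsHom (R := R) (n := n) e)).toRingHom)
  exact (congrArg RingHom.FaithfullyFlat key).mp h'

theorem faithfullyFlat_rootsHom_fin (R : Type*) [CommRing R] [Nontrivial R] (n : ℕ) :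
    (rootsHom R (Fin n) n : MvPolynomial (Fin n) R →+* MvPolynomial (Fin n) R).FaithfullyFlat := by
  induction n generalizing R with
  | zero =>
    have : rootsHom R (Fin 0) 0 = .id R _ := by ext i; exact i.elim0
    rw [this]
    exact .of_bijective Function.bijective_id
  | succ n ih =>
    have h₁ := ((faithfullyFlat_splitRoot R n).comp (ih (Polynomial R))).comp
      (.of_bijective (f := (optionEquivRight R (Fin n)).symm.toRingEquiv.toRingHom)
        (optionEquivRight R (Fin n)).symm.bijective)
    rw [rootsHom_option] at h₁
    exact faithfullyFlat_rootsHom_of_equiv (finSuccEquiv n).symm h₁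

theorem faithfullyFlat_rootsHom [Nontrivial R] (hn : Fintype.card σ = n) :
    (rootsHom R σ n : MvPolynomial (Fin n) R →+* MvPolynomial σ R).FaithfullyFlat := by
  subst hn
  exact faithfullyFlat_rootsHom_of_equiv (Fintype.equivFin σ).symm
    (faithfullyFlat_rootsHom_fin R _)

end RootsHom

section RegularSeq

lemma isRegularSeq_of_isWeaklyRegular {A : Type*} [CommRing A] {l : List A}
    (h : RingTheory.Sequence.IsWeaklyRegular A l) : IsRegularSeq l := by
  intro i hi x hx
  have := h.regular_mod_prev i hi
  rw [isSMulRegular_quotient_iff_mem_of_smul_mem] at this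
  simpa [Ideal.ofList] using this x (by simpa [Ideal.ofList] using hx)

lemma isWeaklyRegular_of_isRegularSeq {A : Type*} [CommRing A] {l : List A}
    (h : IsRegularSeq l) : RingTheory.Sequence.IsWeaklyRegular A l := by
  refine ⟨fun i hi => ?_⟩
  rw [isSMulRegular_quotient_iff_mem_of_smul_mem]
  intro x hx
  simpa [Ideal.ofList] using h i hi x (by simpa [Ideal.ofList] using hx)

lemma IsRegularSeq.map_of_flat {A B : Type*} [CommRing A] [CommRing B] {f : A →+* B}
    (hf : f.Flat) {l : List A} (h : IsRegularSeq l) : IsRegularSeq (l.map f) := by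
  algebraize [f]
  exact isRegularSeq_of_isWeaklyRegular (isWeaklyRegular_of_isRegularSeq h).of_flat

lemma isRegularSeq_of_map {A B : Type*} [CommRing A] [CommRing B] {f : A →+* B}
    (hf : f.FaithfullyFlat) {l : List A} (h : IsRegularSeq (l.map f)) : IsRegularSeq l := by
  algebraize [f]
  intro i hi x hx
  have key : Ideal.span {y | y ∈ (l.map f).take i} = (Ideal.span {y | y ∈ l.take i}).map f := by
    rw [Ideal.map_span, ← List.map_take]
    congr 1
    ext
    simp only [Set.mem_ofPred_eq, Set.mem_image, List.mem_map]
  have := h i (by simpa using hi) (f x)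
  rw [key] at this
  have h2 := this (by simpa using Ideal.mem_map_of_mem f hx)
  rwa [← Ideal.mem_comap, ← RingHom.algebraMap_toAlgebra f,
    Ideal.comap_map_eq_self_of_faithfullyFlat] at h2

lemma isRegularSeq_map_X {R σ : Type*} [CommRing R] {l : List σ} (hl : l.Nodup) :
    IsRegularSeq (l.map (X : σ → MvPolynomial σ R)) := by
  intro i hi x hx
  have hi' : i < l.length := by simpa using hi
  have key : {y | y ∈ (l.map (X : σ → MvPolynomial σ R)).take i} = X '' {s | s ∈ l.take i} := by
    rw [← List.map_take]
    ext
    simp only [Set.mem_ofPred_eq, Set.mem_image, List.mem_map]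
  rw [key, mem_ideal_span_X_image] at hx ⊢
  intro d hd
  obtain ⟨j, hj, hne⟩ := hx (.single l[i] 1 + d) (by simpa [coeff_X_mul] using hd)
  refine ⟨j, hj, ?_⟩
  have : l[i] ≠ j := by
    rintro rfl
    obtain ⟨k, hk, hk'⟩ := List.mem_iff_getElem.mp hj
    rw [List.getElem_take, hl.getElem_inj_iff] at hk'
    simp at hk
    lia
  simpa [Finsupp.single_apply, this] using hne

end RegularSeq

section Blocks

variable (K : Type*) [CommRing K] {ι : Type} (n : ι → ℕ)

/-- The monic polynomial whose roots are the variables of the block `k`. -/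
noncomputable def blockSplit (k : ι) : Polynomial (MvPolynomial (Σ i, Fin (n i)) K) :=
  ∏ i : Fin (n k), (.X - .C (X ⟨k, i⟩))

open Classical in
/-- The map replacing the variables of each block in `s` by the coefficients of the monic
polynomial having these variables as roots. -/
noncomputable def blockHom (s : Finset ι) :
    MvPolynomial (Σ i, Fin (n i)) K →ₐ[K] MvPolynomial (Σ i, Fin (n i)) K :=
  aeval fun x => if x.1 ∈ s then (blockSplit K n x.1).coeff x.2 else X x

variable {K n}

lemma monic_blockSplit (k : ι) : (blockSplit K n k).Monic :=
  Polynomial.monic_prod_of_monic _ _ fun _ _ => Polynomial.monic_X_sub_C _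

lemma natDegree_blockSplit [Nontrivial K] (k : ι) : (blockSplit K n k).natDegree = n k := by
  rw [blockSplit, Polynomial.natDegree_prod_of_monic _ _ fun _ _ => Polynomial.monic_X_sub_C _]
  simp

lemma prod_blockSplit [Fintype ι] : ∏ k, blockSplit K n k = genericSplit K (Σ i, Fin (n i)) := by
  simp only [blockSplit, genericSplit, Fintype.prod_sigma]

lemma blockHom_insert [DecidableEq ι] {k : ι} {s : Finset ι} (hk : k ∉ s) :
    blockHom K n (insert k s) = (blockHom K n {k}).comp (blockHom K n s) := by
  refine MvPolynomial.algHom_ext fun x => ?_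
  by_cases hx : x.1 ∈ s
  · have hne : x.1 ≠ k := by rintro rfl; exact hk hx
    have h : (blockSplit K n x.1).map (blockHom K n {k} : _ →+* MvPolynomial (Σ i, Fin (n i)) K) =
        blockSplit K n x.1 := by
      simp [blockSplit, Polynomial.map_prod, blockHom, hne]
    have h' := congr(($h).coeff x.2)
    rw [Polynomial.coeff_map] at h'
    simpa [blockHom, hx] using h'.symm
  · by_cases hxk : x.1 = k <;> simp [blockHom, hx, hxk, hk]

/-- The variables of the block `k` together with the remaining ones. -/
def sumBlockEquiv [DecidableEq ι] (k : ι) :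
    Fin (n k) ⊕ {x : Σ i, Fin (n i) // ¬ x.1 = k} ≃ Σ i, Fin (n i) :=
  (Equiv.sumCongr (Equiv.sigmaSubtype (β := fun i => Fin (n i)) k).symm (.refl _)).trans
    (Equiv.sumCompl _)

lemma faithfullyFlat_blockHom_singleton [Nontrivial K] (k : ι) :
    (blockHom K n {k}).toRingHom.FaithfullyFlat := by
  classical
  let R' := MvPolynomial {x : Σ i, Fin (n i) // ¬ x.1 = k} K
  let E := sumAlgEquiv K (Fin (n k)) {x : Σ i, Fin (n i) // ¬ x.1 = k}
  let e := renameEquiv K (sumBlockEquiv (n := n) k)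
  let ρ := (rootsHom R' (Fin (n k)) (n k)).restrictScalars K
  have h : (blockHom K n {k}).comp e.toAlgHom =
      (e.toAlgHom.comp E.symm.toAlgHom).comp (ρ.comp E.toAlgHom) := by
    refine MvPolynomial.algHom_ext fun x => ?_
    rcases x with j | x
    · have h3 : E (X (.inl j)) = X j := sumAlgEquiv_X_inl ..
      have h4 (i) : e (X (.inl i)) = X ⟨k, i⟩ := rename_X ..
      have h5 (i) : E.symm (X i) = X (.inl i) := sumAlgEquiv_symm_X ..
      have h1 : ρ (X j) = (genericSplit R' (Fin (n k))).coeff j := by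
        simp [ρ, rootsHom, coeffHom]
      have h2 : (genericSplit R' (Fin (n k))).map (e.toAlgHom.comp E.symm.toAlgHom).toRingHom =
          blockSplit K n k := by
        simp [genericSplit, blockSplit, Polynomial.map_prod, h4, h5]
      calc blockHom K n {k} (e (X (.inl j))) = (blockSplit K n k).coeff j := by
            simp [h4, blockHom]
        _ = (e.toAlgHom.comp E.symm.toAlgHom) (ρ (E (X (.inl j)))) := by
            rw [h3, h1, ← h2, Polynomial.coeff_map]
            rfl
    · have h1 : ρ (C (X x)) = C (X x) :=
        (rootsHom R' (Fin (n k)) (n k)).commutes _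
      simp [E, h1, e, sumBlockEquiv, blockHom, x.2]
  have hρ : ρ.toRingHom.FaithfullyFlat := faithfullyFlat_rootsHom_fin R' (n k)
  have hE : E.toAlgHom.toRingHom.FaithfullyFlat := .of_bijective E.bijective
  have hE' : E.symm.toAlgHom.toRingHom.FaithfullyFlat := .of_bijective E.symm.bijective
  have he : e.toAlgHom.toRingHom.FaithfullyFlat := .of_bijective e.bijective
  have he' : e.symm.toAlgHom.toRingHom.FaithfullyFlat := .of_bijective e.symm.bijective
  have hcomp := he'.comp ((hE.comp hρ).comp (hE'.comp he))
  have key : (blockHom K n {k}).toRingHom =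
      ((e.toAlgHom.comp E.symm.toAlgHom).comp (ρ.comp E.toAlgHom)).toRingHom.comp
        e.symm.toAlgHom.toRingHom := by
    rw [← h]
    ext x <;> simp
  rw [key]
  exact hcomp

theorem faithfullyFlat_blockHom [Nontrivial K] (s : Finset ι) :
    (blockHom K n s).toRingHom.FaithfullyFlat := by
  classical
  induction s using Finset.induction_on with
  | empty =>
    have : blockHom K n ∅ = .id K _ := by ext; simp [blockHom]
    rw [this]
    exact .of_bijective Function.bijective_id
  | insert k s hk ih =>
    rw [blockHom_insert hk]
    exact ih.comp (faithfullyFlat_blockHom_singleton k)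

end Blocks

section Qpoly

variable {K : Type*} [CommRing K] {m : ℕ} {n : Fin m → ℕ}

variable (K n) in
/-- The monic polynomial with coefficients the variables of the block `k`. -/
noncomputable def blockPoly (k : Fin m) : Polynomial (MvPolynomial (Σ i, Fin (n i)) K) :=
  ∑ j ∈ Finset.range (n k + 1), .monomial (n k - j) (Xc K m n k j)

lemma coeff_prod_blockPoly {a : ℕ} (ha : a ≤ ∑ k, n k) :
    (∏ k, blockPoly K n k).coeff (∑ k, n k - a) = Qpoly K m n a := by
  have hm (t : Fin m → ℕ) : ∏ k, Polynomial.monomial (n k - t k) (Xc K m n k (t k)) =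
      Polynomial.monomial (∑ k, (n k - t k)) (∏ k, Xc K m n k (t k)) := by
    simp only [← Polynomial.C_mul_X_pow_eq_monomial, Finset.prod_mul_distrib,
      Finset.prod_pow_eq_pow_sum, map_prod]
  simp only [blockPoly, Finset.prod_univ_sum, Polynomial.finsetSum_coeff, hm,
    Polynomial.coeff_monomial, Qpoly, Finset.sum_filter]
  refine Finset.sum_congr rfl fun t ht => ?_
  have ht' (k) (_ : k ∈ Finset.univ) : t k ≤ n k := by
    have := Fintype.mem_piFinset.mp ht k
    simp at this
    lia
  have h1 := Finset.sum_tsub_distrib Finset.univ ht'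
  have h2 := Finset.sum_le_sum ht'
  congr 1
  rw [h1, eq_iff_iff]
  lia

lemma coeff_blockPoly (k : Fin m) (i : ℕ) :
    (blockPoly K n k).coeff i = if i ≤ n k then Xc K m n k (n k - i) else 0 := by
  simp only [blockPoly, Polynomial.finsetSum_coeff, Polynomial.coeff_monomial]
  split_ifs with h
  · rw [Finset.sum_eq_single (n k - i)]
    · rw [if_pos (by lia)]
    · intro j hj hne
      simp at hj
      rw [if_neg (by lia)]
    · intro h
      simp at h
  · exact Finset.sum_eq_zero fun j hj => if_neg (by lia)

variable (K n) in
/-- The map sending `X_{k,j}` to the coefficient of degree `n k - j` of `blockSplit K n k`. -/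
noncomputable def revBlockHom :
    MvPolynomial (Σ i, Fin (n i)) K →ₐ[K] MvPolynomial (Σ i, Fin (n i)) K :=
  (blockHom K n Finset.univ).comp (rename (Equiv.sigmaCongrRight fun _ => Fin.revPerm))

lemma faithfullyFlat_revBlockHom [Nontrivial K] :
    (revBlockHom K n).toRingHom.FaithfullyFlat :=
  (RingHom.FaithfullyFlat.of_bijective
    (f := (rename (R := K) (Equiv.sigmaCongrRight fun i => Fin.revPerm (n := n i))).toRingHom)
    (renameEquiv K _).bijective).comp
    (faithfullyFlat_blockHom Finset.univ)

lemma map_blockPoly [Nontrivial K] (k : Fin m) :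
    (blockPoly K n k).map (revBlockHom K n : _ →+* MvPolynomial (Σ i, Fin (n i)) K) =
      blockSplit K n k := by
  ext1 i
  rw [Polynomial.coeff_map, coeff_blockPoly]
  rcases lt_trichotomy i (n k) with h | rfl | h
  · rw [if_pos h.le, Xc, dif_pos (by lia)]
    simp [revBlockHom, blockHom, Fin.rev]
    congr 1
    lia
  · have := (monic_blockSplit (K := K) (n := n) k).coeff_natDegree
    rw [natDegree_blockSplit] at this
    simp [Xc, this]
  · rw [if_neg (by lia), map_zero,
      Polynomial.coeff_eq_zero_of_natDegree_lt (by rwa [natDegree_blockSplit])]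

lemma revBlockHom_Qpoly [Nontrivial K] {a : ℕ} (ha : a ≤ ∑ k, n k) :
    revBlockHom K n (Qpoly K m n a) =
      (genericSplit K (Σ i, Fin (n i))).coeff (∑ k, n k - a) := by
  rw [← coeff_prod_blockPoly ha, ← prod_blockSplit]
  simp_rw [← map_blockPoly]
  rw [← Polynomial.map_prod, Polynomial.coeff_map]
  rfl

end Qpoly

/-- `Q₁, Q₂, …, Q_N` is an `A`-regular sequence, where `N = n₁ + ⋯ + n_m`. -/
theorem stmt_7 (K : Type*) [Field K] (m : ℕ) (hm : 1 ≤ m) (n : Fin m → ℕ)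
    (hn : ∀ i, 1 ≤ n i) :
    IsRegularSeq ((List.range (∑ i, n i)).map fun a => Qpoly K m n (a + 1)) := by
  refine isRegularSeq_of_map (f := (revBlockHom K n).toRingHom)
    faithfullyFlat_revBlockHom ?_
  have hflat := faithfullyFlat_rootsHom (R := K) (σ := Σ i, Fin (n i)) (n := ∑ i, n i) (by simp)
  convert (isRegularSeq_map_X (R := K) (l := (List.finRange (∑ i, n i)).map Fin.rev)
    ((List.nodup_finRange _).map Fin.rev_injective)).map_of_flat hflat.flat using 1
  refine List.ext_getElem (by simp) fun a h _ => ?_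
  have ha : a + 1 ≤ ∑ i, n i := by simpa using h
  simp [revBlockHom_Qpoly ha, rootsHom, coeffHom]
end

section
/- Let K be a field, m ≥ 1, and n₁,…,n_m positive integers. Let A = K[X_{i,j} : 1 ≤ i ≤ m, 1 ≤ j ≤ nᵢ], and with the convention X_{k,0} := 1 define, for 1 ≤ a ≤ N := n₁ + ⋯ + n_m, Q_a := Σ X_{1,i₁}⋯X_{m,i_m}, the sum over all tuples (i₁,…,i_m) with 0 ≤ i_k ≤ n_k and i₁ + ⋯ + i_m = a. Let I be the ideal of A generated by Q₁,…,Q_N. Then A/I is a finite-dimensional K-vector space of dimension (n₁ + ⋯ + n_m)! / (n₁!·n₂!·⋯·n_m!). -/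
open MvPolynomial

universe u

namespace Polynomial

/-- The `R`-algebra `S` with the elements `s k i` is universal among the `R`-algebras over which
each `f k` with `k ∈ T` splits as `∏ i, (X - s k i)`. -/
structure IsUniversalSplitting {R S : Type u} [CommRing R] [CommRing S] [Algebra R S]
    {κ : Type*} {ι : κ → Type*} [∀ k, Fintype (ι k)] (T : Finset κ) (f : κ → R[X])
    (s : ∀ k, ι k → S) : Prop where
  map_eq_prod : ∀ k ∈ T, (f k).map (algebraMap R S) = ∏ i, (X - C (s k i))
  exists_lift : ∀ {B : Type u} [CommRing B] (ψ : R →+* B) (b : ∀ k, ι k → B),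
    (∀ k ∈ T, (f k).map ψ = ∏ i, (X - C (b k i))) →
      ∃ h : S →+* B, h.comp (algebraMap R S) = ψ ∧ ∀ k ∈ T, ∀ i, h (s k i) = b k i
  hom_ext : ∀ {B : Type u} [CommRing B] (g h : S →+* B),
    g.comp (algebraMap R S) = h.comp (algebraMap R S) →
      (∀ k ∈ T, ∀ i, g (s k i) = h (s k i)) → g = h

/-- Two universal splittings of the same polynomials are isomorphic. -/
theorem IsUniversalSplitting.nonempty_algEquiv {R S S' : Type u} [CommRing R] [CommRing S]
    [CommRing S'] [Algebra R S] [Algebra R S'] {κ : Type*} {ι : κ → Type*} [∀ k, Fintype (ι k)]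
    {T : Finset κ} {f : κ → R[X]} {s : ∀ k, ι k → S} {s' : ∀ k, ι k → S'}
    (hs : IsUniversalSplitting T f s) (hs' : IsUniversalSplitting T f s') :
    Nonempty (S ≃ₐ[R] S') := by
  obtain ⟨g, hg, hgs⟩ := hs.exists_lift (algebraMap R S') s' hs'.map_eq_prod
  obtain ⟨h, hh, hhs⟩ := hs'.exists_lift (algebraMap R S) s hs.map_eq_prod
  have hgh : h.comp g = RingHom.id S := hs.hom_ext _ _
    (by rw [RingHom.comp_assoc, hg, hh, RingHom.id_comp])
    fun k hk i => by simp [hgs k hk, hhs k hk]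
  have hhg : g.comp h = RingHom.id S' := hs'.hom_ext _ _
    (by rw [RingHom.comp_assoc, hh, hg, RingHom.id_comp])
    fun k hk i => by simp [hgs k hk, hhs k hk]
  exact ⟨AlgEquiv.ofRingEquiv (f := RingEquiv.ofRingHom g h hhg hgh)
    fun r => congr($hg r)⟩

/-- A monic polynomial of degree `d` has a universal splitting that is free of rank `d!`. -/
theorem exists_isUniversalSplitting_fin (d : ℕ) :
    ∀ (R : Type u) [CommRing R] [Nontrivial R] (f : R[X]), f.Monic → f.natDegree = d →
      ∃ (S : Type u) (_ : CommRing S) (_ : Algebra R S) (s : Fin d → S),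
        Nonempty (Module.Basis (Fin d.factorial) R S) ∧
        IsUniversalSplitting (Finset.univ : Finset Unit) (fun _ => f) (fun _ => s) := by
  induction d with
  | zero =>
    intro R _ _ f hf hd
    obtain rfl : f = 1 := hf.natDegree_eq_zero.mp hd
    refine ⟨R, inferInstance, inferInstance, Fin.elim0, ⟨Module.Basis.singleton (Fin 1) R⟩,
      ⟨by simp, fun ψ b _ => ⟨ψ, by ext; simp, fun k _ i => i.elim0⟩, fun g h H _ => ?_⟩⟩
    simpa using H
  | succ d ih =>
    intro R _ _ f hf hd
    have B₁ := (AdjoinRoot.powerBasis' hf).basis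
    rw [AdjoinRoot.powerBasis'_dim, hd] at B₁
    have : Nontrivial (AdjoinRoot f) := B₁.repr.toEquiv.nontrivial
    have hroot : (f.map (AdjoinRoot.of f)).IsRoot (AdjoinRoot.root f) := by
      rw [IsRoot, eval_map, AdjoinRoot.eval₂_root]
    obtain ⟨q, hq⟩ : ∃ q, (X - C (AdjoinRoot.root f)) * q = f.map (AdjoinRoot.of f) :=
      ⟨_, mul_divByMonic_eq_iff_isRoot.mpr hroot⟩
    have hqm : q.Monic := (monic_X_sub_C _).of_mul_monic_left (hq ▸ hf.map _)
    have hqd : q.natDegree = d := by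
      have h := congr(natDegree $hq)
      rw [(monic_X_sub_C _).natDegree_mul hqm, natDegree_X_sub_C, hf.natDegree_map, hd] at h
      omega
    obtain ⟨S, _, _, s, ⟨B₂⟩, hs⟩ := ih (AdjoinRoot f) q hqm hqd
    let : Algebra R S := ((algebraMap (AdjoinRoot f) S).comp (AdjoinRoot.of f)).toAlgebra
    have hRS : algebraMap R S = (algebraMap (AdjoinRoot f) S).comp (AdjoinRoot.of f) := rfl
    have : IsScalarTower R (AdjoinRoot f) S := .of_algebraMap_eq' hRS
    refine ⟨S, inferInstance, inferInstance, Fin.cons (algebraMap _ S (AdjoinRoot.root f)) s,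
      ⟨(B₁.smulTower B₂).reindex finProdFinEquiv⟩, ⟨?_, ?_, ?_⟩⟩
    · intro k hk
      rw [hRS, ← map_map, ← hq, Polynomial.map_mul, hs.map_eq_prod k hk, Fin.prod_univ_succ]
      simp
    · intro B _ ψ b hb
      have hb' := hb () (Finset.mem_univ _)
      rw [Fin.prod_univ_succ] at hb'
      have h0 : eval₂ ψ (b () 0) f = 0 := by rw [← eval_map, hb']; simp
      obtain ⟨h, hh, hhs⟩ := hs.exists_lift (AdjoinRoot.lift ψ (b () 0) h0)
        (fun k i => b k i.succ) (by
          intro k _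
          refine (monic_X_sub_C (b () 0)).isRegular.left ?_
          change _ * _ = _ * _
          rw [← hb']
          have hψ := congr(f.map $(AdjoinRoot.lift_comp_of h0))
          rw [← map_map, ← hq] at hψ
          simpa using hψ)
      refine ⟨h, by rw [hRS, ← RingHom.comp_assoc, hh, AdjoinRoot.lift_comp_of], ?_⟩
      intro k hk i
      refine Fin.cases ?_ (fun i => ?_) i
      · simpa using congr($hh (AdjoinRoot.root f))
      · simpa using hhs k hk i
    · intro B _ g h hgh hs'
      refine hs.hom_ext g h (AdjoinRoot.ringHom_ext ?_ ?_) fun k hk i => ?_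
      · simpa only [RingHom.comp_assoc, hRS] using hgh
      · simpa using hs' () (Finset.mem_univ _) 0
      · simpa using hs' k hk i.succ

/-- A family of monic polynomials of degrees `n k`, for `k ∈ T`, has a universal splitting that is
free of rank `∏ k ∈ T, (n k)!`. -/
theorem exists_isUniversalSplitting {R : Type u} [CommRing R] [Nontrivial R] {κ : Type*}
    [DecidableEq κ] (n : κ → ℕ) (f : κ → R[X]) (hf : ∀ k, (f k).Monic)
    (hn : ∀ k, (f k).natDegree = n k) (T : Finset κ) :
    ∃ (S : Type u) (_ : CommRing S) (_ : Algebra R S) (s : ∀ k, Fin (n k) → S),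
      Nonempty (Module.Basis (Fin (∏ k ∈ T, (n k).factorial)) R S) ∧
      IsUniversalSplitting T f s := by
  induction T using Finset.induction_on with
  | empty =>
    refine ⟨R, inferInstance, inferInstance, fun _ _ => 0, ⟨Module.Basis.singleton (Fin 1) R⟩,
      ⟨by simp, fun ψ b _ => ⟨ψ, by ext; simp, by simp⟩, fun g h H _ => ?_⟩⟩
    simpa using H
  | insert a T ha ih =>
    obtain ⟨S₁, _, _, s₁, ⟨B₁⟩, hs₁⟩ := ih
    have : Nonempty (Fin (∏ k ∈ T, (n k).factorial)) :=
      ⟨0, Finset.prod_pos fun k _ => (n k).factorial_pos⟩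
    have : Nontrivial S₁ := B₁.repr.toEquiv.nontrivial
    obtain ⟨S, _, _, s₂, ⟨B₂⟩, hs₂⟩ := exists_isUniversalSplitting_fin (n a) S₁
      ((f a).map (algebraMap R S₁)) ((hf a).map _) (by rw [(hf a).natDegree_map, hn])
    let : Algebra R S := ((algebraMap S₁ S).comp (algebraMap R S₁)).toAlgebra
    have hRS : algebraMap R S = (algebraMap S₁ S).comp (algebraMap R S₁) := rfl
    have : IsScalarTower R S₁ S := .of_algebraMap_eq' hRS
    have hne : ∀ k ∈ T, k ≠ a := fun k hk h => ha (h ▸ hk)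
    have hu : ∀ k ∈ T, Function.update (fun k i => algebraMap S₁ S (s₁ k i)) a s₂ k =
        fun i => algebraMap S₁ S (s₁ k i) := fun k hk =>
      Function.update_of_ne (hne k hk) _ _
    refine ⟨S, inferInstance, inferInstance,
      Function.update (fun k i => algebraMap S₁ S (s₁ k i)) a s₂,
      ⟨(B₁.smulTower B₂).reindex (finProdFinEquiv.trans (finCongr (by
        rw [Finset.prod_insert ha, mul_comm])))⟩, ⟨?_, ?_, ?_⟩⟩
    · refine Finset.forall_mem_insert _ _ _ |>.mpr ⟨?_, fun k hk => ?_⟩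
      · rw [hRS, ← map_map, hs₂.map_eq_prod () (Finset.mem_univ _)]
        simp
      · rw [hRS, ← map_map, hs₁.map_eq_prod k hk, hu k hk]
        simp [Polynomial.map_prod]
    · intro B _ ψ b hb
      obtain ⟨h₁, hh₁, hhs₁⟩ := hs₁.exists_lift ψ b fun k hk => hb k (Finset.mem_insert_of_mem hk)
      obtain ⟨h, hh, hhs⟩ := hs₂.exists_lift h₁ (fun _ => b a) fun _ _ => by
        rw [map_map, hh₁, hb a (Finset.mem_insert_self _ _)]
      refine ⟨h, by rw [hRS, ← RingHom.comp_assoc, hh, hh₁], ?_⟩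
      refine Finset.forall_mem_insert _ _ _ |>.mpr ⟨?_, fun k hk i => ?_⟩
      · simpa using hhs () (Finset.mem_univ _)
      · rw [hu k hk, ← hhs₁ k hk, ← hh, RingHom.comp_apply]
    · intro B _ g h hgh hs'
      refine hs₂.hom_ext g h (hs₁.hom_ext _ _ ?_ fun k hk i => ?_) fun _ _ i => ?_
      · simpa only [RingHom.comp_assoc, hRS] using hgh
      · simpa [hu k hk] using hs' k (Finset.mem_insert_of_mem hk) i
      · simpa using hs' a (Finset.mem_insert_self _ _) i

end Polynomial

section UniversalFactorization

open Polynomial (IsUniversalSplitting)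

variable (K : Type u) {m : ℕ} (n : Fin m → ℕ)

/-- The monic polynomial `∑ j, X_{k,j} T ^ (n k - j)` over `K[X_{i,j}]`. -/
noncomputable def genericFactor [CommRing K] (k : Fin m) :
    Polynomial (MvPolynomial (Σ i : Fin m, Fin (n i)) K) :=
  ∑ j ∈ Finset.range (n k + 1), Polynomial.monomial (n k - j) (Xc K m n k j)

theorem coeff_genericFactor [CommRing K] (k : Fin m) {j : ℕ} (hj : j ≤ n k) :
    (genericFactor K n k).coeff (n k - j) = Xc K m n k j := by
  rw [genericFactor, Polynomial.finsetSum_coeff, Finset.sum_eq_single j]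
  · simp
  · intro i hi hij
    rw [Finset.mem_range] at hi
    exact Polynomial.coeff_monomial_of_ne _ (by omega)
  · simp only [Finset.mem_range]
    omega

theorem natDegree_genericFactor_le [CommRing K] (k : Fin m) :
    (genericFactor K n k).natDegree ≤ n k :=
  Polynomial.natDegree_sum_le_of_forall_le _ _ fun _ _ =>
    (Polynomial.natDegree_monomial_le _).trans (Nat.sub_le _ _)

theorem monic_genericFactor [CommRing K] (k : Fin m) : (genericFactor K n k).Monic :=
  Polynomial.monic_of_natDegree_le_of_coeff_eq_one _ (natDegree_genericFactor_le K n k) <| by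
    simpa [Xc] using coeff_genericFactor K n k (Nat.zero_le _)

theorem natDegree_genericFactor [CommRing K] [Nontrivial K] (k : Fin m) :
    (genericFactor K n k).natDegree = n k :=
  (natDegree_genericFactor_le K n k).antisymm <| Polynomial.le_natDegree_of_ne_zero <| by
    have := coeff_genericFactor K n k (Nat.zero_le _)
    simp_all [Xc]

theorem prod_genericFactor [CommRing K] :
    ∏ k, genericFactor K n k =
      ∑ a ∈ Finset.range (∑ k, n k + 1), Polynomial.monomial (∑ k, n k - a) (Qpoly K m n a) := by
  simp only [genericFactor, Finset.prod_univ_sum]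
  rw [← Finset.sum_fiberwise_of_maps_to (t := Finset.range (∑ k, n k + 1))
    (g := fun t => ∑ k, t k)]
  · refine Finset.sum_congr rfl fun a _ => ?_
    rw [Qpoly, map_sum]
    refine Finset.sum_congr rfl fun t ht => ?_
    simp only [Finset.mem_filter, Fintype.mem_piFinset, Finset.mem_range] at ht
    rw [← ht.2, ← Finset.sum_tsub_distrib _ fun k _ => Nat.le_of_lt_succ (ht.1 k)]
    simp only [← Polynomial.C_mul_X_pow_eq_monomial, Finset.prod_mul_distrib,
      Finset.prod_pow_eq_pow_sum, map_prod]
  · intro t ht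
    simp only [Fintype.mem_piFinset, Finset.mem_range] at ht ⊢
    exact Nat.lt_succ_of_le (Finset.sum_le_sum fun k _ => Nat.le_of_lt_succ (ht k))

theorem coeff_prod_genericFactor [CommRing K] {a : ℕ} (ha : a ≤ ∑ k, n k) :
    (∏ k, genericFactor K n k).coeff (∑ k, n k - a) = Qpoly K m n a := by
  rw [prod_genericFactor, Polynomial.finsetSum_coeff, Finset.sum_eq_single a]
  · simp
  · intro i hi hij
    rw [Finset.mem_range] at hi
    exact Polynomial.coeff_monomial_of_ne _ (by omega)
  · simp only [Finset.mem_range]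
    omega

theorem Qpoly_zero [CommRing K] [Nontrivial K] : Qpoly K m n 0 = 1 := by
  have h := (Polynomial.monic_prod_of_monic Finset.univ (genericFactor K n)
    fun k _ => monic_genericFactor K n k).coeff_natDegree
  rw [Polynomial.natDegree_prod_of_monic _ _ fun k _ => monic_genericFactor K n k] at h
  simp only [natDegree_genericFactor] at h
  rw [← h, ← coeff_prod_genericFactor K n (Nat.zero_le _), Nat.sub_zero]

/-- A choice of a monic polynomial of degree `n k` for each `k` determines a specialization of the
generic factors. -/
theorem exists_map_genericFactor [CommRing K] {B : Type u} [CommRing B] (ψ : K →+* B)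
    (p : Fin m → Polynomial B) (hp : ∀ k, (p k).coeff (n k) = 1)
    (hd : ∀ k, (p k).natDegree ≤ n k) :
    ∃ φ : MvPolynomial (Σ i : Fin m, Fin (n i)) K →+* B,
      φ.comp MvPolynomial.C = ψ ∧ ∀ k, (genericFactor K n k).map φ = p k := by
  refine ⟨eval₂Hom ψ fun i => (p i.1).coeff (n i.1 - (i.2 + 1)), by ext; simp, fun k => ?_⟩
  have hX : ∀ j ≤ n k, eval₂Hom ψ (fun i => (p i.1).coeff (n i.1 - (i.2 + 1))) (Xc K m n k j) =
      (p k).coeff (n k - j) := by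
    intro j hj
    rw [Xc]
    rcases Nat.eq_zero_or_pos j with rfl | hj'
    · simp [hp k]
    · rw [dif_pos ⟨hj', hj⟩]
      simp [Nat.sub_add_cancel hj']
  ext i
  rw [Polynomial.coeff_map]
  rcases le_or_gt i (n k) with hi | hi
  · obtain ⟨j, hj, rfl⟩ : ∃ j ≤ n k, i = n k - j := ⟨n k - i, by omega, by omega⟩
    rw [coeff_genericFactor K n k hj, hX j hj]
  · rw [Polynomial.coeff_eq_zero_of_natDegree_lt ((natDegree_genericFactor_le K n k).trans_lt hi),
      Polynomial.coeff_eq_zero_of_natDegree_lt ((hd k).trans_lt hi), map_zero]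

/-- Specializations that agree on the generic factors are equal. -/
theorem hom_ext_genericFactor [CommRing K] {B : Type u} [CommRing B]
    {g h : MvPolynomial (Σ i : Fin m, Fin (n i)) K →+* B}
    (hC : g.comp MvPolynomial.C = h.comp MvPolynomial.C)
    (hF : ∀ k, (genericFactor K n k).map g = (genericFactor K n k).map h) : g = h := by
  refine MvPolynomial.ringHom_ext (fun r => congr($hC r)) fun ⟨k, j⟩ => ?_
  have hX : Xc K m n k (j + 1) = X ⟨k, j⟩ := by
    rw [Xc, dif_pos ⟨Nat.le_add_left _ _, j.isLt⟩]
    rfl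
  rw [← hX, ← coeff_genericFactor K n k j.isLt, ← Polynomial.coeff_map, hF, Polynomial.coeff_map]

/-- The ideal generated by `Q_1, …, Q_N`. -/
noncomputable abbrev factorizationIdeal [CommRing K] :
    Ideal (MvPolynomial (Σ i : Fin m, Fin (n i)) K) :=
  Ideal.span {p | ∃ a, 1 ≤ a ∧ a ≤ ∑ i, n i ∧ p = Qpoly K m n a}

/-- The ring representing factorizations of `T ^ N` into monic factors of degrees `n k`. -/
abbrev FactorizationRing [CommRing K] : Type u :=
  MvPolynomial (Σ i : Fin m, Fin (n i)) K ⧸ factorizationIdeal K n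

theorem factorizationIdeal_le_ker_iff [CommRing K] [Nontrivial K] {B : Type u} [CommRing B]
    (φ : MvPolynomial (Σ i : Fin m, Fin (n i)) K →+* B) :
    factorizationIdeal K n ≤ RingHom.ker φ ↔
      ∏ k, (genericFactor K n k).map φ = Polynomial.X ^ (∑ k, n k) := by
  rw [← Polynomial.map_prod]
  constructor
  · intro h
    have hQ : ∀ a, 1 ≤ a → a ≤ ∑ k, n k → φ (Qpoly K m n a) = 0 := fun a h₁ h₂ =>
      h (Ideal.subset_span ⟨a, h₁, h₂, rfl⟩)
    rw [prod_genericFactor, Polynomial.map_sum, Finset.sum_eq_single 0]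
    · rw [Polynomial.map_monomial, Qpoly_zero, map_one, Nat.sub_zero,
        Polynomial.monomial_one_right_eq_X_pow]
    · intro a ha ha0
      rw [Finset.mem_range] at ha
      rw [Polynomial.map_monomial, hQ a (by omega) (by omega), map_zero]
    · simp
  · intro h
    refine Ideal.span_le.mpr ?_
    rintro _ ⟨a, h₁, h₂, rfl⟩
    rw [SetLike.mem_coe, RingHom.mem_ker, ← coeff_prod_genericFactor K n h₂,
      ← Polynomial.coeff_map, h, Polynomial.coeff_X_pow, if_neg (by omega)]

theorem nontrivial_factorizationRing [CommRing K] [Nontrivial K] :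
    Nontrivial (FactorizationRing K n) := by
  obtain ⟨φ, -, hφ⟩ := exists_map_genericFactor K n (RingHom.id K) (fun k => Polynomial.X ^ n k)
    (fun k => by simp) (fun k => Polynomial.natDegree_X_pow_le _)
  refine Ideal.Quotient.nontrivial_iff.mpr fun h => RingHom.ker_ne_top φ (top_le_iff.mp ?_)
  rw [← h, factorizationIdeal_le_ker_iff]
  simp [hφ, Finset.prod_pow_eq_pow_sum]

/-- A universal splitting of the generic factors modulo `Q_1, …, Q_N` is a universal splitting
of `T ^ N`. -/
theorem isUniversalSplitting_X_pow [CommRing K] [Nontrivial K] {S : Type u} [CommRing S]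
    [Algebra K S] [Algebra (FactorizationRing K n) S]
    [IsScalarTower K (FactorizationRing K n) S]
    {s : ∀ k, Fin (n k) → S}
    (hs : IsUniversalSplitting Finset.univ
      (fun k => (genericFactor K n k).map (Ideal.Quotient.mk (factorizationIdeal K n))) s) :
    IsUniversalSplitting (Finset.univ : Finset Unit)
      (fun _ => (Polynomial.X ^ (∑ k, n k) : Polynomial K))
      (fun _ i => s (finSigmaFinEquiv.symm i).1 (finSigmaFinEquiv.symm i).2) := by
  have hKS : algebraMap K S = (algebraMap (FactorizationRing K n) S).comp
      ((Ideal.Quotient.mk (factorizationIdeal K n)).comp MvPolynomial.C) :=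
    IsScalarTower.algebraMap_eq K (FactorizationRing K n) S
  have hprod : ∀ {B : Type u} [CommRing B] (b : Fin (∑ k, n k) → B),
      ∏ i, (Polynomial.X - Polynomial.C (b i)) =
        ∏ k, ∏ j, (Polynomial.X - Polynomial.C (b (finSigmaFinEquiv ⟨k, j⟩))) := by
    intro B _ b
    rw [← Fintype.prod_sigma', ← finSigmaFinEquiv.prod_comp]
  refine ⟨fun _ _ => ?_, fun {B} _ ψ b hb => ?_, fun {B} _ g h hgh hs' => ?_⟩
  · have h := (factorizationIdeal_le_ker_iff K n ((algebraMap (FactorizationRing K n) S).comp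
      (Ideal.Quotient.mk (factorizationIdeal K n)))).mp fun x hx => by
        rw [RingHom.mem_ker, RingHom.comp_apply, Ideal.Quotient.eq_zero_iff_mem.mpr hx, map_zero]
    rw [hprod, Polynomial.map_pow, Polynomial.map_X, ← h]
    refine Finset.prod_congr rfl fun k hk => ?_
    rw [← Polynomial.map_map, hs.map_eq_prod k hk]
    refine Finset.prod_congr rfl fun j _ => ?_
    rw [Equiv.symm_apply_apply]
  · obtain ⟨φ, hφ, hφF⟩ := exists_map_genericFactor K n ψ
      (fun k => ∏ j, (Polynomial.X - Polynomial.C (b () (finSigmaFinEquiv ⟨k, j⟩))))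
      (fun k => by
        nontriviality B
        simpa using (Polynomial.monic_prod_X_sub_C
          (fun j => b () (finSigmaFinEquiv ⟨k, j⟩)) Finset.univ).coeff_natDegree)
      (fun k => by
        nontriviality B
        simp)
    have hI : factorizationIdeal K n ≤ RingHom.ker φ := by
      rw [factorizationIdeal_le_ker_iff]
      simp only [hφF, ← hprod]
      simpa using (hb () (Finset.mem_univ _)).symm
    obtain ⟨h, hh, hhs⟩ := hs.exists_lift
      (Ideal.Quotient.lift (factorizationIdeal K n) φ fun _ hx => RingHom.mem_ker.mp (hI hx))
      (fun k j => b () (finSigmaFinEquiv ⟨k, j⟩)) fun k _ => by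
        rw [Polynomial.map_map, Ideal.Quotient.lift_comp_mk, hφF]
    refine ⟨h, ?_, fun _ _ i => ?_⟩
    · rw [hKS, ← RingHom.comp_assoc, hh, ← RingHom.comp_assoc, Ideal.Quotient.lift_comp_mk, hφ]
    · rw [hhs _ (Finset.mem_univ _), Sigma.eta, Equiv.apply_symm_apply]
  · have hs'' : ∀ k j, g (s k j) = h (s k j) := fun k j => by
      have := hs' () (Finset.mem_univ _) (finSigmaFinEquiv ⟨k, j⟩)
      rwa [Equiv.symm_apply_apply] at this
    refine hs.hom_ext g h (Ideal.Quotient.ringHom_ext (hom_ext_genericFactor K n ?_ fun k => ?_))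
      fun k _ => hs'' k
    · simpa only [hKS, RingHom.comp_assoc] using hgh
    · simp only [← Polynomial.map_map]
      rw [hs.map_eq_prod k (Finset.mem_univ _)]
      simp [Polynomial.map_prod, hs'']

end UniversalFactorization

/-- `A/I`, where `I = (Q₁, …, Q_N)`, is a finite-dimensional `K`-vector space of dimension
`(n₁ + ⋯ + n_m)! / (n₁! ⋯ n_m!)`. -/
theorem stmt_8 (K : Type*) [Field K] (m : ℕ) (hm : 1 ≤ m) (n : Fin m → ℕ)
    (hn : ∀ i, 1 ≤ n i) :
    Module.Finite K
      (MvPolynomial (Σ i : Fin m, Fin (n i)) K ⧸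
        Ideal.span {p | ∃ a, 1 ≤ a ∧ a ≤ ∑ i, n i ∧ p = Qpoly K m n a}) ∧
    Module.finrank K
      (MvPolynomial (Σ i : Fin m, Fin (n i)) K ⧸
        Ideal.span {p | ∃ a, 1 ≤ a ∧ a ≤ ∑ i, n i ∧ p = Qpoly K m n a}) =
      (∑ i, n i).factorial / ∏ i, (n i).factorial := by
  change Module.Finite K (FactorizationRing K n) ∧
    Module.finrank K (FactorizationRing K n) = _
  have := nontrivial_factorizationRing K n
  have hmonic := fun k => (monic_genericFactor K n k).map
    (Ideal.Quotient.mk (factorizationIdeal K n))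
  obtain ⟨S, _, _, s, ⟨b⟩, hs⟩ := Polynomial.exists_isUniversalSplitting n _ hmonic
    (fun k => by rw [(monic_genericFactor K n k).natDegree_map, natDegree_genericFactor])
    Finset.univ
  let : Algebra K S :=
    ((algebraMap (FactorizationRing K n) S).comp (algebraMap K (FactorizationRing K n))).toAlgebra
  have : IsScalarTower K (FactorizationRing K n) S :=
    IsScalarTower.of_algebraMap_eq (R := K) (S := FactorizationRing K n) (A := S) fun _ => rfl
  obtain ⟨S', _, _, s', ⟨b'⟩, hs'⟩ := Polynomial.exists_isUniversalSplitting_fin (∑ k, n k) K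
    (Polynomial.X ^ _) (Polynomial.monic_X_pow _) (Polynomial.natDegree_X_pow _)
  obtain ⟨e⟩ := hs'.nonempty_algEquiv (isUniversalSplitting_X_pow K n hs)
  have b'' := b'.map e.toLinearEquiv
  have : Module.Finite K S := .of_basis b''
  have : Module.Free (FactorizationRing K n) S := .of_basis b
  have hpos : 0 < ∏ k, (n k).factorial := Finset.prod_pos fun k _ => (n k).factorial_pos
  have : Nonempty (Fin (∏ k, (n k).factorial)) := ⟨0, hpos⟩
  have : Nontrivial S := b.repr.toEquiv.nontrivial
  have hfin : Module.Finite K (FactorizationRing K n) :=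
    .of_injective (IsScalarTower.toAlgHom K (FactorizationRing K n) S).toLinearMap
    (FaithfulSMul.algebraMap_injective (FactorizationRing K n) S)
  refine ⟨hfin, (Nat.div_eq_of_eq_mul_left hpos ?_).symm⟩
  have h := Module.finrank_mul_finrank K (FactorizationRing K n) S
  rw [Module.finrank_eq_card_basis b, Module.finrank_eq_card_basis b''] at h
  simpa using h.symm
end

section
/- Let q ≥ 1 and n₁,…,n_q be positive integers, and let P be the polynomial ring over 𝔽₂ = ℤ/2 in the indeterminates β_i^{(p)} for 1 ≤ p ≤ q and 1 ≤ i ≤ ⌊n_p/2⌋. With the conventions β_0^{(p)} := 1, β_i^{(p)} := β_{n_p−i}^{(p)} for ⌊n_p/2⌋ < i ≤ n_p, and β_i^{(p)} := 0 for i < 0 or i > n_p, define μ_m := Σ_{a₁+⋯+a_q = m} β_{a₁}^{(1)}⋯β_{a_q}^{(q)} and μ̃_m := μ_m + (binom(n₁+⋯+n_q, m) mod 2). Set h := ⌊n₁/2⌋ + ⋯ + ⌊n_q/2⌋. Then the quotient P/(μ̃₁,…,μ̃_h) is a finite-dimensional 𝔽₂-vector space of dimension h! / (⌊n₁/2⌋!·⌊n₂/2⌋!·⋯·⌊n_q/2⌋!).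 -/
open MvPolynomial

/-- The element `β_i^{(p)}` of the polynomial ring `P` over `𝔽₂` in the indeterminates
`β_i^{(p)}`, `1 ≤ p ≤ q`, `1 ≤ i ≤ ⌊n_p/2⌋`, with the conventions `β_0^{(p)} = 1`,
`β_i^{(p)} = β_{n_p−i}^{(p)}` for `⌊n_p/2⌋ < i ≤ n_p`, and `β_i^{(p)} = 0` for `i > n_p`. -/
noncomputable def bb (q : ℕ) (n : Fin q → ℕ) (p : Fin q) (i : ℕ) :
    MvPolynomial (Σ p : Fin q, Fin (n p / 2)) (ZMod 2) :=
  if h : i ≤ n p then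
    (if h1 : 1 ≤ min i (n p - i) then X ⟨p, ⟨min i (n p - i) - 1, by omega⟩⟩ else 1)
  else 0

/-- `μ_m := Σ_{a₁+⋯+a_q = m} β_{a₁}^{(1)} ⋯ β_{a_q}^{(q)}`. -/
noncomputable def muP (q : ℕ) (n : Fin q → ℕ) (m : ℕ) :
    MvPolynomial (Σ p : Fin q, Fin (n p / 2)) (ZMod 2) :=
  ∑ a ∈ (Fintype.piFinset fun _ : Fin q => Finset.range (m + 1)).filter
      (fun a => ∑ p, a p = m),
    ∏ p, bb q n p (a p)

/-- `μ̃_m := μ_m + (binom(n₁+⋯+n_q, m) mod 2)`. -/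
noncomputable def muTildeP (q : ℕ) (n : Fin q → ℕ) (m : ℕ) :
    MvPolynomial (Σ p : Fin q, Fin (n p / 2)) (ZMod 2) :=
  muP q n m + (Nat.choose (∑ p, n p) m : MvPolynomial (Σ p : Fin q, Fin (n p / 2)) (ZMod 2))

namespace Polynomial

open scoped Polynomial

section Palindromize

variable {R S : Type*} [CommRing R] [CommRing S]

/-- The linear map sending a polynomial `f` of degree at most `m` to the palindromic polynomial
`X ^ m * f (X + X⁻¹)` of degree at most `2 * m`. -/
noncomputable def palindromize (R : Type*) [CommRing R] (m : ℕ) : R[X] →ₗ[R] R[X] :=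
  ∑ j ∈ Finset.range (m + 1), (lcoeff R j).smulRight (X ^ (m - j) * (1 + X ^ 2) ^ j)

lemma palindromize_apply (m : ℕ) (f : R[X]) :
    palindromize R m f =
      ∑ j ∈ Finset.range (m + 1), f.coeff j • (X ^ (m - j) * (1 + X ^ 2) ^ j : R[X]) := by
  simp [palindromize, LinearMap.sum_apply]

lemma palindromize_monomial {m j : ℕ} (hj : j ≤ m) (c : R) :
    palindromize R m (monomial j c) = c • (X ^ (m - j) * (1 + X ^ 2) ^ j : R[X]) := by
  rw [palindromize_apply, Finset.sum_eq_single j]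
  · simp
  · intro i _ hi
    simp [coeff_monomial, hi.symm]
  · intro h
    exact absurd (Finset.mem_range.2 (by lia)) h

lemma palindromize_succ (m : ℕ) (f : R[X]) :
    palindromize R (m + 1) f =
      X * palindromize R m f + f.coeff (m + 1) • (1 + X ^ 2 : R[X]) ^ (m + 1) := by
  rw [palindromize_apply, Finset.sum_range_succ, palindromize_apply, Finset.mul_sum]
  congr 1
  · refine Finset.sum_congr rfl fun j hj => ?_
    rw [Nat.succ_sub (Nat.lt_succ_iff.1 (Finset.mem_range.1 hj)), pow_succ', mul_smul_comm,
      mul_assoc]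
  · simp

lemma palindromize_zero (f : R[X]) : palindromize R 0 f = C (f.coeff 0) := by
  simp [palindromize_apply, smul_eq_C_mul]

lemma palindromize_map (φ : R →+* S) (m : ℕ) (f : R[X]) :
    (palindromize R m f).map φ = palindromize S m (f.map φ) := by
  simp [palindromize_apply, Polynomial.map_sum, smul_eq_C_mul]

lemma palindromize_mul {m k : ℕ} {f g : R[X]} (hf : f.natDegree ≤ m) (hg : g.natDegree ≤ k) :
    palindromize R (m + k) (f * g) = palindromize R m f * palindromize R k g := by
  rw [as_sum_range' f (m + 1) (by lia), as_sum_range' g (k + 1) (by lia), Finset.sum_mul_sum]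
  simp only [map_sum, Finset.sum_mul_sum]
  refine Finset.sum_congr rfl fun i hi => Finset.sum_congr rfl fun j hj => ?_
  have hi : i ≤ m := Nat.lt_succ_iff.1 (Finset.mem_range.1 hi)
  have hj : j ≤ k := Nat.lt_succ_iff.1 (Finset.mem_range.1 hj)
  rw [monomial_mul_monomial, palindromize_monomial (by lia), palindromize_monomial hi,
    palindromize_monomial hj, show m + k - (i + j) = (m - i) + (k - j) by lia]
  simp only [smul_eq_C_mul, C_mul, pow_add]
  ring

lemma palindromize_prod {ι : Type*} (s : Finset ι) (m : ι → ℕ) (f : ι → R[X])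
    (hf : ∀ i ∈ s, (f i).natDegree ≤ m i) :
    palindromize R (∑ i ∈ s, m i) (∏ i ∈ s, f i) = ∏ i ∈ s, palindromize R (m i) (f i) := by
  classical
  induction s using Finset.induction_on with
  | empty => simp [palindromize_zero]
  | insert a s ha ih =>
    simp only [Finset.mem_insert, forall_eq_or_imp] at hf
    rw [Finset.sum_insert ha, Finset.prod_insert ha, Finset.prod_insert ha,
      palindromize_mul hf.1, ih hf.2]
    exact (natDegree_prod_le _ _).trans (Finset.sum_le_sum hf.2)

lemma natDegree_one_add_X_sq_pow_le (m : ℕ) :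
    ((1 + X ^ 2 : R[X]) ^ m).natDegree ≤ 2 * m := by
  refine (natDegree_pow_le_of_le m (?_ : _ ≤ 2)).trans (by lia)
  compute_degree

lemma natDegree_palindromize_le (m : ℕ) (f : R[X]) : (palindromize R m f).natDegree ≤ 2 * m := by
  induction m with
  | zero => simp [palindromize_zero]
  | succ m ih =>
    rw [palindromize_succ]
    refine natDegree_add_le_of_degree_le ?_ ?_
    · exact (natDegree_mul_le.trans (Nat.add_le_add natDegree_X_le ih)).trans (by lia)
    · exact (natDegree_smul_le _ _).trans (natDegree_one_add_X_sq_pow_le _)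

lemma reflect_one_add_X_sq_pow (m : ℕ) :
    reflect (2 * m) ((1 + X ^ 2 : R[X]) ^ m) = (1 + X ^ 2) ^ m := by
  induction m with
  | zero => simp
  | succ m ih =>
    rw [pow_succ, mul_add, reflect_mul _ _ (natDegree_one_add_X_sq_pow_le m)
      (by compute_degree), ih]
    congr 1
    simp [reflect_add, reflect_one, add_comm]

lemma reflect_palindromize (m : ℕ) (f : R[X]) :
    reflect (2 * m) (palindromize R m f) = palindromize R m f := by
  induction m with
  | zero => simp [palindromize_zero]
  | succ m ih =>
    have hX : reflect 2 (X : R[X]) = X := by simpa using reflect_monomial (R := R) 2 1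
    rw [palindromize_succ, reflect_add, smul_eq_C_mul, reflect_C_mul, reflect_one_add_X_sq_pow,
      mul_add, mul_one, add_comm (2 * m),
      reflect_mul _ _ (natDegree_X_le.trans one_le_two) (natDegree_palindromize_le m f), hX, ih]

lemma coeff_zero_palindromize (m : ℕ) (f : R[X]) :
    (palindromize R m f).coeff 0 = f.coeff m := by
  cases m with
  | zero => simp [palindromize_zero]
  | succ m => simp [palindromize_succ, coeff_zero_eq_eval_zero]

lemma coeff_eq_zero_of_palindromize {m : ℕ} {f : R[X]}
    (h : ∀ i ≤ m, (palindromize R m f).coeff i = 0) : ∀ j ≤ m, f.coeff j = 0 := by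
  induction m with
  | zero =>
    intro j hj
    obtain rfl : j = 0 := by lia
    simpa [palindromize_zero] using h 0 le_rfl
  | succ m ih =>
    have hm : f.coeff (m + 1) = 0 := by rw [← coeff_zero_palindromize, h 0 (by lia)]
    intro j hj
    obtain hj | rfl : j ≤ m ∨ j = m + 1 := by lia
    · refine ih (fun i hi => ?_) j hj
      simpa [palindromize_succ, hm] using h (i + 1) (by lia)
    · exact hm

lemma exists_palindromize_eq {m : ℕ} {g : R[X]} (hg : g.natDegree ≤ 2 * m)
    (hr : reflect (2 * m) g = g) : ∃ f : R[X], f.natDegree ≤ m ∧ palindromize R m f = g := by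
  induction m generalizing g with
  | zero => exact ⟨g, hg, by rw [palindromize_zero, ← eq_C_of_natDegree_le_zero hg]⟩
  | succ m ih =>
    set E : R[X] := g - g.coeff 0 • (1 + X ^ 2 : R[X]) ^ (m + 1) with hE
    have hEr : reflect (2 * (m + 1)) E = E := by
      rw [hE, reflect_sub, hr, smul_eq_C_mul, reflect_C_mul, reflect_one_add_X_sq_pow]
    have hE0 : E.coeff 0 = 0 := by simp [hE, coeff_zero_eq_eval_zero]
    have hEd : E.natDegree ≤ 2 * (m + 1) := (natDegree_sub_le_of_le hg
      ((natDegree_smul_le _ _).trans (natDegree_one_add_X_sq_pow_le _))).trans (by simp)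
    have hEX : X * divX E = E := by
      conv_rhs => rw [← X_mul_divX_add E, hE0]
      simp
    have hEs (i : ℕ) (hi : i ≤ 2 * m + 2) : E.coeff (2 * m + 2 - i) = E.coeff i := by
      conv_rhs => rw [← hEr, coeff_reflect, revAt_le (by lia)]
      rfl
    obtain ⟨f, hf, hfE⟩ := ih (g := divX E)
      (by
        rw [natDegree_le_iff_coeff_eq_zero]
        intro i hi
        rw [coeff_divX]
        obtain hi | hi : i + 1 = 2 * m + 2 ∨ 2 * (m + 1) < i + 1 := by lia
        · rw [hi, ← hEs _ le_rfl, Nat.sub_self, hE0]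
        · exact coeff_eq_zero_of_natDegree_lt (hEd.trans_lt hi))
      (by
        ext i
        rw [coeff_reflect]
        obtain hi | hi := le_or_gt i (2 * m)
        · rw [revAt_le hi, coeff_divX, coeff_divX, ← hEs (i + 1) (by lia)]
          congr 1
          lia
        · rw [revAt_eq_self_of_lt hi])
    have hz : palindromize R m (monomial (m + 1) (g.coeff 0)) = 0 := by
      rw [palindromize_apply]
      refine Finset.sum_eq_zero fun j hj => ?_
      rw [coeff_monomial, if_neg (by rw [Finset.mem_range] at hj; lia), zero_smul]
    refine ⟨f + monomial (m + 1) (g.coeff 0), natDegree_add_le_of_degree_le (by lia)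
      (natDegree_monomial_le _), ?_⟩
    rw [palindromize_succ, map_add, hz, add_zero, hfE, hEX, coeff_add, coeff_monomial_same,
      coeff_eq_zero_of_natDegree_lt (by lia), zero_add, hE, sub_add_cancel]

lemma coeff_eq_zero_of_one_add_X_pow_mul {e m : ℕ} {f : R[X]}
    (h : ∀ i ≤ m, ((1 + X) ^ e * f).coeff i = 0) : ∀ i ≤ m, f.coeff i = 0 := by
  have hdvd : X ^ (m + 1) ∣ (1 + X : R[X]) ^ e * f :=
    X_pow_dvd_iff.2 fun i hi => h i (by lia)
  have hcop : IsCoprime (X ^ (m + 1) : R[X]) ((1 + X) ^ e) :=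
    IsCoprime.pow ⟨-1, 1, by ring⟩
  exact fun i hi => X_pow_dvd_iff.1 (hcop.dvd_of_dvd_mul_left hdvd) i (by lia)

lemma one_add_X_monic : (1 + X : R[X]).Monic := by
  rw [add_comm]
  exact monic_X_add_C 1

lemma natDegree_one_add_X_pow_le (e : ℕ) : ((1 + X : R[X]) ^ e).natDegree ≤ e := by
  refine (natDegree_pow_le_of_le e (?_ : _ ≤ 1)).trans (by lia)
  compute_degree

lemma reflect_one_add_X_pow (e : ℕ) : reflect e ((1 + X : R[X]) ^ e) = (1 + X) ^ e := by
  induction e with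
  | zero => simp
  | succ e ih =>
    rw [pow_succ, reflect_mul _ _ (natDegree_one_add_X_pow_le e) (by compute_degree), ih]
    congr 1
    simp [reflect_add, reflect_one, add_comm]

lemma eval_one_eq_zero_of_reflect_eq [CharP R 2] {n : ℕ} (hn : Odd n) {g : R[X]}
    (hg : g.natDegree ≤ n) (hr : reflect n g = g) : g.eval 1 = 0 := by
  rw [eval_eq_sum_range' (Nat.lt_succ_iff.2 hg)]
  simp only [one_pow, mul_one]
  have hs (i : ℕ) (hi : i ≤ n) : g.coeff (n - i) = g.coeff i := by
    conv_rhs => rw [← hr, coeff_reflect, revAt_le hi]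
  refine Finset.sum_involution (fun i _ => n - i) ?_ ?_ ?_ ?_
  · intro i hi
    rw [hs i (by simpa [Nat.lt_succ_iff] using hi), CharTwo.add_self_eq_zero]
  · intro i hi _ h
    obtain ⟨k, rfl⟩ := hn
    rw [Finset.mem_range] at hi
    lia
  · intro i hi
    rw [Finset.mem_range]
    lia
  · intro i hi
    rw [Finset.mem_range] at hi
    lia

lemma exists_one_add_X_mul_eq [CharP R 2] {k : ℕ} {g : R[X]}
    (hg : g.natDegree ≤ 2 * k + 1) (hr : reflect (2 * k + 1) g = g) :
    ∃ d : R[X], d.natDegree ≤ 2 * k ∧ reflect (2 * k) d = d ∧ g = (1 + X) * d := by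
  nontriviality R
  have hX : (X - C 1 : R[X]) = 1 + X := by
    rw [CharTwo.sub_eq_add, C_1, add_comm]
  obtain ⟨d, hd⟩ : (X - C 1 : R[X]) ∣ g :=
    dvd_iff_isRoot.2 (eval_one_eq_zero_of_reflect_eq ⟨k, rfl⟩ hg hr)
  rw [hX] at hd
  have hdd : d.natDegree ≤ 2 * k := by
    by_cases h0 : d = 0
    · simp [h0]
    have h1 : (1 + X : R[X]).natDegree = 1 := by
      rw [add_comm]; exact natDegree_X_add_C 1
    rw [hd, one_add_X_monic.natDegree_mul' h0, h1] at hg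
    lia
  refine ⟨d, hdd, one_add_X_monic.isRegular.left ?_, hd⟩
  have := hr
  rw [hd, add_comm, reflect_mul _ _ (by compute_degree) hdd] at this
  simpa [reflect_add, reflect_one, add_comm] using this

/-- The palindromic polynomial of degree at most `n` attached to a polynomial of degree at most
`n / 2`; in characteristic two every palindromic polynomial arises in this way. -/
noncomputable def palindromicLift (n : ℕ) (f : R[X]) : R[X] :=
  (1 + X) ^ (n % 2) * palindromize R (n / 2) f

lemma palindromicLift_map (φ : R →+* S) (n : ℕ) (f : R[X]) :
    (palindromicLift n f).map φ = palindromicLift n (f.map φ) := by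
  simp [palindromicLift, palindromize_map]

lemma natDegree_palindromicLift_le (n : ℕ) (f : R[X]) : (palindromicLift n f).natDegree ≤ n :=
  (natDegree_mul_le.trans (Nat.add_le_add (natDegree_one_add_X_pow_le _)
    (natDegree_palindromize_le _ f))).trans (by lia)

lemma reflect_palindromicLift (n : ℕ) (f : R[X]) :
    reflect n (palindromicLift n f) = palindromicLift n f := by
  have := reflect_mul ((1 + X : R[X]) ^ (n % 2)) (palindromize R (n / 2) f)
    (natDegree_one_add_X_pow_le _) (natDegree_palindromize_le _ f)
  rwa [reflect_one_add_X_pow, reflect_palindromize, Nat.mod_add_div] at this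

lemma coeff_zero_palindromicLift (n : ℕ) (f : R[X]) :
    (palindromicLift n f).coeff 0 = f.coeff (n / 2) := by
  rw [palindromicLift, mul_coeff_zero, coeff_zero_palindromize, coeff_zero_eq_eval_zero]
  simp

lemma exists_palindromicLift_eq [CharP R 2] {n : ℕ} {g : R[X]} (hg : g.natDegree ≤ n)
    (hr : reflect n g = g) : ∃ f : R[X], f.natDegree ≤ n / 2 ∧ palindromicLift n f = g := by
  obtain ⟨k, rfl | rfl⟩ := n.even_or_odd'
  · obtain ⟨f, hf, rfl⟩ := exists_palindromize_eq hg hr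
    exact ⟨f, by lia, by simp [palindromicLift]⟩
  · obtain ⟨d, hd, hdr, rfl⟩ := exists_one_add_X_mul_eq hg hr
    obtain ⟨f, hf, rfl⟩ := exists_palindromize_eq hd hdr
    refine ⟨f, by lia, ?_⟩
    rw [palindromicLift, show (2 * k + 1) % 2 = 1 by lia, show (2 * k + 1) / 2 = k by lia, pow_one]

lemma prod_palindromicLift {ι : Type*} [Fintype ι] (n : ι → ℕ) (f : ι → R[X])
    (hf : ∀ i, (f i).natDegree ≤ n i / 2) :
    ∏ i, palindromicLift (n i) (f i) =
      (1 + X) ^ (∑ i, n i % 2) * palindromize R (∑ i, n i / 2) (∏ i, f i) := by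
  simp only [palindromicLift]
  rw [Finset.prod_mul_distrib, Finset.prod_pow_eq_pow_sum,
    palindromize_prod _ _ _ fun i _ => hf i]

lemma one_add_X_pow_eq [CharP R 2] {ι : Type*} [Fintype ι] (n : ι → ℕ) :
    (1 + X : R[X]) ^ (∑ i, n i) =
      (1 + X) ^ (∑ i, n i % 2) * palindromize R (∑ i, n i / 2) (X ^ (∑ i, n i / 2)) := by
  have h : (1 + X ^ 2 : R[X]) = (1 + X) ^ 2 := by rw [CharTwo.add_sq, one_pow]
  rw [X_pow_eq_monomial, palindromize_monomial le_rfl, one_smul, Nat.sub_self, pow_zero, one_mul,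
    h, ← pow_mul, ← pow_add, Finset.mul_sum, ← Finset.sum_add_distrib]
  simp only [Nat.mod_add_div]

lemma eq_of_palindromize_coeff_eq {e m : ℕ} {f g : R[X]} (hf : f.natDegree ≤ m)
    (hg : g.natDegree ≤ m)
    (h : ∀ i ≤ m, ((1 + X) ^ e * palindromize R m f).coeff i =
      ((1 + X) ^ e * palindromize R m g).coeff i) : f = g := by
  rw [← sub_eq_zero]
  have h0 : ∀ j ≤ m, (f - g).coeff j = 0 :=
    coeff_eq_zero_of_palindromize <| coeff_eq_zero_of_one_add_X_pow_mul (e := e) fun i hi => by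
      rw [map_sub, mul_sub, coeff_sub, h i hi, sub_self]
  ext j
  obtain hj | hj := le_or_gt j m
  · exact h0 j hj
  · exact coeff_eq_zero_of_natDegree_lt
      (((natDegree_sub_le _ _).trans (max_le hf hg)).trans_lt hj)

lemma palindromicLift_injOn {n : ℕ} {f g : R[X]} (hf : f.natDegree ≤ n / 2)
    (hg : g.natDegree ≤ n / 2) (h : palindromicLift n f = palindromicLift n g) : f = g :=
  eq_of_palindromize_coeff_eq (e := n % 2) hf hg fun i _ => by
    rw [← palindromicLift, ← palindromicLift, h]

end Palindromize

end Polynomial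

namespace Polynomial

open scoped Polynomial

section Splitting

universe u

/-- `S` is the universal ring over `R` in which every `f p` acquires a factorization into linear
factors, with roots `r p i`, and it is finite free over `R` of the expected rank. -/
structure IsUniversalSplitting_s10 {R S : Type u} [CommRing R] [CommRing S] [Algebra R S]
    {ι : Type*} {κ : ι → Type*} [∀ p, Fintype (κ p)] (s : Finset ι) (f : ι → R[X])
    (r : ∀ p, κ p → S) : Prop where
  prod_eq : ∀ p ∈ s, ∏ i, (X - C (r p i)) = (f p).map (algebraMap R S)
  exists_lift : ∀ (T : Type u) [CommRing T] (φ : R →+* T) (t : ∀ p, κ p → T),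
    (∀ p ∈ s, ∏ i, (X - C (t p i)) = (f p).map φ) →
      ∃ ψ : S →+* T, ψ.comp (algebraMap R S) = φ ∧ ∀ p ∈ s, ∀ i, ψ (r p i) = t p i
  hom_ext : ∀ (T : Type u) [CommRing T] (ψ₁ ψ₂ : S →+* T),
    ψ₁.comp (algebraMap R S) = ψ₂.comp (algebraMap R S) →
      (∀ p ∈ s, ∀ i, ψ₁ (r p i) = ψ₂ (r p i)) → ψ₁ = ψ₂
  free : Module.Free R S
  finite : Module.Finite R S
  finrank_eq : Module.finrank R S = ∏ p ∈ s, (Fintype.card (κ p)).factorial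

lemma exists_universalSplitting_fin (n : ℕ) : ∀ {R : Type u} [CommRing R] [Nontrivial R]
    (f : R[X]), f.Monic → f.natDegree = n →
    ∃ (S : Type u) (_ : CommRing S) (_ : Algebra R S) (r : Fin n → S),
      IsUniversalSplitting_s10 {()} (fun _ => f) (fun _ : Unit => r) := by
  induction n with
  | zero =>
    intro R _ _ f hf hn
    have h1 : f = 1 := eq_one_of_monic_natDegree_zero hf hn
    refine ⟨R, inferInstance, inferInstance, Fin.elim0, ?_, ?_, ?_, inferInstance, inferInstance, ?_⟩
    · simp [h1]
    · intro T _ φ t _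
      exact ⟨φ, by ext; simp, by simp⟩
    · intro T _ ψ₁ ψ₂ h _
      simpa using h
    · simp
  | succ n ih =>
    intro R _ _ f hf hn
    have hfree : Module.Free R (AdjoinRoot f) := hf.free_adjoinRoot
    have hfin : Module.Finite R (AdjoinRoot f) := hf.finite_adjoinRoot
    have hrank : Module.finrank R (AdjoinRoot f) = n + 1 := by
      rw [(AdjoinRoot.powerBasis' hf).finrank, AdjoinRoot.powerBasis'_dim, hn]
    have : Nontrivial (AdjoinRoot f) :=
      Module.nontrivial_of_finrank_pos (R := R) (by lia)
    set a := AdjoinRoot.root f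
    set f' := f.map (algebraMap R (AdjoinRoot f)) with hf'
    have hfm : f'.Monic := hf.map _
    obtain ⟨g, hg⟩ : X - C a ∣ f' := dvd_iff_isRoot.2 (AdjoinRoot.isRoot_root f)
    have hgm : g.Monic := (monic_X_sub_C a).of_mul_monic_left (hg ▸ hfm)
    have hgd : g.natDegree = n := by
      have := hf.natDegree_map (algebraMap R (AdjoinRoot f))
      rw [← hf', hg, (monic_X_sub_C a).natDegree_mul hgm, natDegree_X_sub_C, hn] at this
      lia
    obtain ⟨S, _, _, r, hS⟩ := ih g hgm hgd
    have := hS.free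
    have := hS.finite
    let _ : Algebra R S := ((algebraMap (AdjoinRoot f) S).comp (algebraMap R (AdjoinRoot f))).toAlgebra
    have : IsScalarTower R (AdjoinRoot f) S := .of_algebraMap_eq fun _ => rfl
    refine ⟨S, inferInstance, inferInstance, Fin.cons (algebraMap _ S a) r, ?_, ?_, ?_,
      .trans (S := AdjoinRoot f), .trans (AdjoinRoot f) S, ?_⟩
    · intro p hp
      have := hS.prod_eq p hp
      rw [Fin.prod_univ_succ]
      simp only [Fin.cons_zero, Fin.cons_succ, this]
      rw [IsScalarTower.algebraMap_eq R (AdjoinRoot f) S, ← Polynomial.map_map, ← hf', hg]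
      simp
    · intro T _ φ t ht
      have ht := ht () (by simp)
      rw [Fin.prod_univ_succ] at ht
      have hroot : f.eval₂ φ (t () 0) = 0 := by
        rw [← eval_map, ← ht]
        simp
      set φ' : AdjoinRoot f →+* T := AdjoinRoot.lift φ (t () 0) hroot
      have hφ : φ'.comp (algebraMap R (AdjoinRoot f)) = φ := AdjoinRoot.lift_comp_of hroot
      have hφa : φ' a = t () 0 := AdjoinRoot.lift_root hroot
      obtain ⟨ψ, hψ, hψr⟩ := hS.exists_lift T φ' (fun _ i => t () i.succ) fun p _ => by
        refine (monic_X_sub_C (t () 0)).isRegular.left ?_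
        change _ * _ = _ * _
        rw [ht, ← hφ, ← Polynomial.map_map, ← hf', hg]
        simp [hφa]
      refine ⟨ψ, ?_, ?_⟩
      · rw [IsScalarTower.algebraMap_eq R (AdjoinRoot f) S, ← RingHom.comp_assoc, hψ, hφ]
      · intro p hp i
        induction i using Fin.cases with
        | zero => simpa [← hφa] using congr($hψ a)
        | succ i => simpa using hψr p hp i
    · intro T _ ψ₁ ψ₂ h hr
      have hr := hr () (by simp)
      refine hS.hom_ext T ψ₁ ψ₂ ?_ fun p _ i => by simpa using hr i.succ
      refine AdjoinRoot.ringHom_ext ?_ (by simpa using hr 0)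
      exact h
    · rw [← Module.finrank_mul_finrank R (AdjoinRoot f) S, hS.finrank_eq, hrank]
      simp [Nat.factorial_succ]

lemma exists_universalSplitting_single {R : Type u} [CommRing R] [Nontrivial R] {κ : Type*}
    [Fintype κ] (f : R[X]) (hf : f.Monic) (hn : f.natDegree = Fintype.card κ) :
    ∃ (S : Type u) (_ : CommRing S) (_ : Algebra R S) (r : κ → S),
      IsUniversalSplitting_s10 {()} (fun _ => f) (fun _ : Unit => r) := by
  obtain ⟨S, _, _, r, hS⟩ := exists_universalSplitting_fin _ f hf hn
  let e := Fintype.equivFin κ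
  refine ⟨S, inferInstance, inferInstance, r ∘ e, ?_, ?_, ?_, hS.free, hS.finite, ?_⟩
  · intro p hp
    rw [← hS.prod_eq p hp]
    exact e.prod_comp fun i => X - C (r i)
  · intro T _ φ t ht
    obtain ⟨ψ, hψ, hψr⟩ := hS.exists_lift T φ (fun p => t p ∘ e.symm) fun p hp => by
      rw [← ht p hp]
      exact e.symm.prod_comp fun i => X - C (t p i)
    exact ⟨ψ, hψ, fun p hp i => by simpa using hψr p hp (e i)⟩
  · exact fun T _ ψ₁ ψ₂ h hr => hS.hom_ext T ψ₁ ψ₂ h fun p hp i => by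
      simpa using hr p hp (e.symm i)
  · simpa using hS.finrank_eq

lemma exists_universalSplitting {R : Type u} [CommRing R] [Nontrivial R] {ι : Type*}
    {κ : ι → Type*} [∀ p, Fintype (κ p)] (s : Finset ι) (f : ι → R[X])
    (hf : ∀ p, (f p).Monic) (hn : ∀ p, (f p).natDegree = Fintype.card (κ p)) :
    ∃ (S : Type u) (_ : CommRing S) (_ : Algebra R S) (r : ∀ p, κ p → S),
      IsUniversalSplitting_s10 s f r := by
  classical
  induction s using Finset.induction_on with
  | empty =>
    exact ⟨R, inferInstance, inferInstance, fun _ _ => 0, by simp,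
      fun T _ φ t _ => ⟨φ, by ext; simp, by simp⟩, fun T _ ψ₁ ψ₂ h _ => by simpa using h,
      inferInstance, inferInstance, by simp⟩
  | insert a s ha ih =>
    obtain ⟨A, _, _, r, hA⟩ := ih
    have := hA.free
    have := hA.finite
    have : Nontrivial A := Module.nontrivial_of_finrank_pos (R := R) (by
      rw [hA.finrank_eq]
      exact Finset.prod_pos fun p _ => Nat.factorial_pos _)
    obtain ⟨S, _, _, r', hS⟩ := exists_universalSplitting_single (κ := κ a)
      ((f a).map (algebraMap R A)) ((hf a).map _) (by rw [(hf a).natDegree_map, hn])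
    have := hS.free
    have := hS.finite
    let _ : Algebra R S := ((algebraMap A S).comp (algebraMap R A)).toAlgebra
    have : IsScalarTower R A S := .of_algebraMap_eq fun _ => rfl
    have hne {p : ι} (hp : p ∈ s) : p ≠ a := fun h => ha (h ▸ hp)
    have hRS : algebraMap R S = (algebraMap A S).comp (algebraMap R A) := rfl
    refine ⟨S, inferInstance, inferInstance,
      Function.update (fun p i => algebraMap A S (r p i)) a r', ?_, ?_, ?_,
      .trans (S := A), .trans A S, ?_⟩
    · intro p hp
      rw [hRS, ← Polynomial.map_map]
      obtain rfl | hp := Finset.mem_insert.1 hp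
      · simpa using hS.prod_eq () (by simp)
      · rw [Function.update_of_ne (hne hp), ← hA.prod_eq p hp]
        simp [Polynomial.map_prod]
    · intro T _ φ t ht
      obtain ⟨φ', hφ', hr⟩ := hA.exists_lift T φ t fun p hp => ht p (Finset.mem_insert_of_mem hp)
      obtain ⟨ψ, hψ, hψr⟩ := hS.exists_lift T φ' (fun _ => t a) fun _ _ => by
        rw [ht a (Finset.mem_insert_self _ _), Polynomial.map_map, hφ']
      refine ⟨ψ, by rw [hRS, ← RingHom.comp_assoc, hψ, hφ'], fun p hp i => ?_⟩
      obtain rfl | hp := Finset.mem_insert.1 hp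
      · simpa using hψr () (by simp) i
      · rw [Function.update_of_ne (hne hp), ← hr p hp i, ← hψ]
        rfl
    · intro T _ ψ₁ ψ₂ h hr
      refine hS.hom_ext T ψ₁ ψ₂ (hA.hom_ext T _ _ h fun p hp i => ?_) fun _ _ i => ?_
      · simpa [Function.update_of_ne (hne hp)] using hr p (Finset.mem_insert_of_mem hp) i
      · simpa using hr a (Finset.mem_insert_self _ _) i
    · rw [← Module.finrank_mul_finrank R A S, hS.finrank_eq, hA.finrank_eq,
        Finset.prod_insert ha]
      simp [mul_comm]

end Splitting

end Polynomial

section BetaPoly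

variable (q : ℕ) (n : Fin q → ℕ)

/-- The generating polynomial `∑ i, β_i^{(p)} t ^ i`. -/
noncomputable def betaPoly (p : Fin q) :
    Polynomial (MvPolynomial (Σ p : Fin q, Fin (n p / 2)) (ZMod 2)) :=
  ∑ i ∈ Finset.range (n p + 1), Polynomial.monomial i (bb q n p i)

lemma coeff_betaPoly (p : Fin q) (i : ℕ) : (betaPoly q n p).coeff i = bb q n p i := by
  simp only [betaPoly, Polynomial.finsetSum_coeff, Polynomial.coeff_monomial,
    Finset.sum_ite_eq', Finset.mem_range]
  split_ifs with h
  · rfl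
  · rw [bb, dif_neg (by lia)]

lemma natDegree_betaPoly_le (p : Fin q) : (betaPoly q n p).natDegree ≤ n p := by
  rw [Polynomial.natDegree_le_iff_coeff_eq_zero]
  intro i hi
  rw [coeff_betaPoly, bb, dif_neg (by lia)]

lemma bb_zero (p : Fin q) : bb q n p 0 = 1 := by
  simp [bb]

lemma bb_sub {p : Fin q} {i : ℕ} (hi : i ≤ n p) : bb q n p (n p - i) = bb q n p i := by
  have h : min (n p - i) (n p - (n p - i)) = min i (n p - i) := by lia
  simp only [bb, hi, Nat.sub_le, dif_pos, h]

lemma reflect_betaPoly (p : Fin q) :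
    Polynomial.reflect (n p) (betaPoly q n p) = betaPoly q n p := by
  ext1 i
  rw [Polynomial.coeff_reflect, coeff_betaPoly, coeff_betaPoly]
  obtain hi | hi := le_or_gt i (n p)
  · rw [Polynomial.revAt_le hi, bb_sub q n hi]
  · rw [Polynomial.revAt_eq_self_of_lt hi]

lemma coeff_prod_betaPoly (m : ℕ) : (∏ p, betaPoly q n p).coeff m = muP q n m := by
  rw [← Polynomial.coeff_coe, ← Polynomial.coeToPowerSeries.ringHom_apply, map_prod,
    PowerSeries.coeff_prod, muP]
  simp only [Polynomial.coeToPowerSeries.ringHom_apply, Polynomial.coeff_coe, coeff_betaPoly]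
  refine Finset.sum_bij' (fun a _ => a) (fun a _ => Finsupp.equivFunOnFinite.symm a) ?_ ?_ ?_ ?_ ?_
  · intro a ha
    simp only [Finset.mem_finsuppAntidiag, Finset.subset_univ, and_true] at ha
    simp only [Finset.mem_filter, Fintype.mem_piFinset, Finset.mem_range, Nat.lt_succ_iff]
    exact ⟨fun p => ha ▸ Finset.single_le_sum (fun _ _ => Nat.zero_le _) (Finset.mem_univ p), ha⟩
  · intro a ha
    simpa [Finset.mem_finsuppAntidiag] using (Finset.mem_filter.1 ha).2
  · intro a _
    ext
    simp
  · intro a _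
    rfl
  · intro a _
    rfl

/-- The polynomial ring in the `β_i^{(p)}` classifies tuples of palindromic polynomials with
constant coefficient one. -/
lemma betaPoly_map_aeval {T : Type*} [CommRing T] [Algebra (ZMod 2) T]
    (g : Fin q → Polynomial T) (hd : ∀ p, (g p).natDegree ≤ n p)
    (hr : ∀ p, Polynomial.reflect (n p) (g p) = g p) (h0 : ∀ p, (g p).coeff 0 = 1) (p : Fin q) :
    (betaPoly q n p).map
      (aeval (R := ZMod 2) fun x : (Σ p : Fin q, Fin (n p / 2)) => (g x.1).coeff (x.2 + 1) :
        _ →ₐ[ZMod 2] T).toRingHom = g p := by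
  have hs {i : ℕ} (hi : i ≤ n p) : (g p).coeff (n p - i) = (g p).coeff i := by
    conv_rhs => rw [← hr p, Polynomial.coeff_reflect, Polynomial.revAt_le hi]
  ext1 i
  rw [Polynomial.coeff_map, coeff_betaPoly, bb]
  split_ifs with h1 h2
  · simp only [AlgHom.toRingHom_eq_coe, RingHom.coe_coe, aeval_X]
    rw [Nat.sub_add_cancel h2]
    obtain h | h := min_choice i (n p - i)
    · rw [h]
    · rw [h, hs h1]
  · obtain rfl | rfl : i = 0 ∨ i = n p := by lia
    · simp [h0]
    · rw [← hs le_rfl, Nat.sub_self]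
      simp [h0]
  · rw [map_zero, Polynomial.coeff_eq_zero_of_natDegree_lt ((hd p).trans_lt (by lia))]

/-- Ring homomorphisms out of the polynomial ring over `𝔽₂` in the `β_i^{(p)}` are determined by
their values on the generating polynomials. -/
lemma ringHom_ext_of_betaPoly {T : Type*} [Semiring T]
    {φ ψ : MvPolynomial (Σ p : Fin q, Fin (n p / 2)) (ZMod 2) →+* T}
    (h : ∀ p, (betaPoly q n p).map φ = (betaPoly q n p).map ψ) : φ = ψ := by
  refine MvPolynomial.ringHom_ext' (Subsingleton.elim _ _) fun x => ?_
  have hx := congr(($(h x.1)).coeff (x.2 + 1))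
  have h2 := x.2.2
  have hb : bb q n x.1 (x.2 + 1) = X x := by
    have hm : min ((x.2 : ℕ) + 1) (n x.1 - (x.2 + 1)) = x.2 + 1 := by lia
    simp only [bb, hm]
    rw [dif_pos (by lia), dif_pos (by lia)]
    rfl
  simpa only [Polynomial.coeff_map, coeff_betaPoly, hb] using hx

end BetaPoly

/-- The quotient of the polynomial ring in the `β_i^{(p)}` by the relations `μ̃₁, …, μ̃_h`. -/
abbrev MuTildeQuotient (q : ℕ) (n : Fin q → ℕ) : Type :=
  MvPolynomial (Σ p : Fin q, Fin (n p / 2)) (ZMod 2) ⧸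
    Ideal.span {x | ∃ i, 1 ≤ i ∧ i ≤ ∑ p, n p / 2 ∧ x = muTildeP q n i}

/-- The quotient classifies factorizations of `X ^ h` into monic factors of degrees `n p / 2`.
Splitting these factors completely over it gives the same ring as splitting `X ^ h` over `𝔽₂`,
which yields a ring whose rank over both base rings is known. -/
lemma exists_splitting_of_muTildeQuotient (q : ℕ) (n : Fin q → ℕ) :
    ∃ (S : Type) (_ : CommRing S) (_ : Algebra (ZMod 2) S) (_ : Algebra (MuTildeQuotient q n) S)
      (_ : IsScalarTower (ZMod 2) (MuTildeQuotient q n) S),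
      Nontrivial (MuTildeQuotient q n) ∧ Module.Finite (ZMod 2) S ∧
      Module.Free (MuTildeQuotient q n) S ∧
      Module.finrank (MuTildeQuotient q n) S = ∏ p, (n p / 2).factorial ∧
      Module.finrank (ZMod 2) S = (∑ p, n p / 2).factorial := by
  set h := ∑ p, n p / 2 with hh
  set I : Ideal (MvPolynomial (Σ p : Fin q, Fin (n p / 2)) (ZMod 2)) :=
    Ideal.span {x | ∃ i, 1 ≤ i ∧ i ≤ h ∧ x = muTildeP q n i}
  set A := MvPolynomial (Σ p : Fin q, Fin (n p / 2)) (ZMod 2) ⧸ I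
  -- the universal splitting of `X ^ h` over `𝔽₂`
  obtain ⟨S₂, _, _, y, hS₂⟩ := Polynomial.exists_universalSplitting_single
    (R := ZMod 2) (κ := Σ p : Fin q, Fin (n p / 2)) (Polynomial.X ^ h)
    (Polynomial.monic_X_pow _) (by simp [hh])
  have hfin₂ := hS₂.finite
  have hrank₂ : Module.finrank (ZMod 2) S₂ = h.factorial := by simpa [hh] using hS₂.finrank_eq
  have hnt₂ : Nontrivial S₂ := Module.nontrivial_of_finrank_pos (R := ZMod 2)
    (hrank₂ ▸ Nat.factorial_pos _)
  have hchar₂ : CharP S₂ 2 := charP_of_injective_algebraMap' (ZMod 2) 2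
  set d : Fin q → Polynomial S₂ := fun p => ∏ i, (Polynomial.X - Polynomial.C (y ⟨p, i⟩)) with hd
  have hdm (p : Fin q) : (d p).Monic := Polynomial.monic_prod_X_sub_C _ _
  have hdd (p : Fin q) : (d p).natDegree = n p / 2 := by simp [hd]
  have hdprod : ∏ p, d p = Polynomial.X ^ h := by
    have := hS₂.prod_eq () (by simp)
    rw [Fintype.prod_sigma] at this
    simpa using this
  -- the classifying map
  set φ₀ : MvPolynomial (Σ p : Fin q, Fin (n p / 2)) (ZMod 2) →+* S₂ :=
    (aeval (R := ZMod 2) fun x : (Σ p : Fin q, Fin (n p / 2)) =>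
      (Polynomial.palindromicLift (n x.1) (d x.1)).coeff (x.2 + 1) : _ →ₐ[ZMod 2] S₂).toRingHom
  have hφ₀ (p : Fin q) : (betaPoly q n p).map φ₀ = Polynomial.palindromicLift (n p) (d p) :=
    betaPoly_map_aeval q n (fun p => Polynomial.palindromicLift (n p) (d p))
      (fun p => Polynomial.natDegree_palindromicLift_le _ _)
      (fun p => Polynomial.reflect_palindromicLift _ _)
      (fun p => by rw [Polynomial.coeff_zero_palindromicLift, ← hdd, (hdm p).coeff_natDegree]) p
  have hφ₀mu (m : ℕ) : φ₀ (muTildeP q n m) = 0 := by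
    have h1 : φ₀ (muP q n m) = ((∑ p, n p).choose m : S₂) := by
      rw [← coeff_prod_betaPoly, ← Polynomial.coeff_map, Polynomial.map_prod]
      simp only [hφ₀]
      rw [Polynomial.prod_palindromicLift n d (fun p => (hdd p).le), hdprod,
        ← Polynomial.one_add_X_pow_eq, Polynomial.coeff_one_add_X_pow]
    rw [muTildeP, map_add, h1, map_natCast, CharTwo.add_self_eq_zero]
  set φ : A →+* S₂ := Ideal.Quotient.lift I φ₀ (fun x hx => by
    refine (Ideal.span_le (I := RingHom.ker φ₀)).2 ?_ hx
    rintro _ ⟨i, _, _, rfl⟩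
    exact hφ₀mu i)
  have hφmk : φ.comp (Ideal.Quotient.mk I) = φ₀ := Ideal.Quotient.lift_comp_mk ..
  have hntA : Nontrivial A := φ.domain_nontrivial
  have hcharA : CharP A 2 := charP_of_injective_algebraMap' (ZMod 2) 2
  -- the tuple of monic polynomials over `A`
  set B : Fin q → Polynomial A := fun p => (betaPoly q n p).map (Ideal.Quotient.mk I) with hB
  have hex (p : Fin q) : ∃ f : Polynomial A,
      f.natDegree ≤ n p / 2 ∧ Polynomial.palindromicLift (n p) f = B p :=
    Polynomial.exists_palindromicLift_eq
      (Polynomial.natDegree_map_le.trans (natDegree_betaPoly_le q n p))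
      (by rw [hB, Polynomial.reflect_map, reflect_betaPoly])
  choose c hcd hcB using hex
  have hc1 (p : Fin q) : (c p).coeff (n p / 2) = 1 := by
    rw [← Polynomial.coeff_zero_palindromicLift, hcB, Polynomial.coeff_map, coeff_betaPoly, bb_zero,
      map_one]
  have hcm (p : Fin q) : (c p).Monic :=
    Polynomial.monic_of_natDegree_le_of_coeff_eq_one _ (hcd p) (hc1 p)
  have hcd' (p : Fin q) : (c p).natDegree = n p / 2 :=
    Polynomial.natDegree_eq_of_le_of_coeff_ne_zero (hcd p) (by simp [hc1])
  have hcprod : ∏ p, c p = Polynomial.X ^ h := by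
    refine Polynomial.eq_of_palindromize_coeff_eq (e := ∑ p, n p % 2) (m := h)
      ((Polynomial.natDegree_prod_le _ _).trans (Finset.sum_le_sum fun p _ => hcd p))
      (Polynomial.natDegree_X_pow_le _) fun i hi => ?_
    rw [← Polynomial.prod_palindromicLift n c hcd, ← Polynomial.one_add_X_pow_eq,
      Polynomial.coeff_one_add_X_pow]
    simp only [hcB, hB]
    rw [← Polynomial.map_prod, Polynomial.coeff_map, coeff_prod_betaPoly]
    obtain rfl | hi0 := Nat.eq_zero_or_pos i
    · rw [← coeff_prod_betaPoly, Polynomial.coeff_zero_prod]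
      simp [coeff_betaPoly, bb_zero]
    · have hmem : Ideal.Quotient.mk I (muTildeP q n i) = 0 :=
        Ideal.Quotient.eq_zero_iff_mem.2 (Ideal.subset_span ⟨i, hi0, hi, rfl⟩)
      rwa [muTildeP, map_add, map_natCast, ← CharTwo.sub_eq_add, sub_eq_zero] at hmem
  have hcφ (p : Fin q) : (c p).map φ = d p := by
    refine Polynomial.palindromicLift_injOn (n := n p)
      (Polynomial.natDegree_map_le.trans (hcd p)) (hdd p).le ?_
    rw [← Polynomial.palindromicLift_map, hcB, hB, Polynomial.map_map, hφmk, hφ₀]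
  -- the universal splitting of that tuple
  obtain ⟨S₁, _, _, x, hS₁⟩ := Polynomial.exists_universalSplitting
    (κ := fun p : Fin q => Fin (n p / 2)) Finset.univ c hcm (by simpa using hcd')
  have hfree₁ := hS₁.free
  let _ : Algebra (ZMod 2) S₁ := ((algebraMap A S₁).comp (algebraMap (ZMod 2) A)).toAlgebra
  have htower : IsScalarTower (ZMod 2) A S₁ := by
    refine ⟨fun r a z => ?_⟩
    have hra : r • a = algebraMap (ZMod 2) A r * a := Algebra.smul_def r a
    rw [hra, Algebra.smul_def, map_mul, mul_assoc, Algebra.smul_def, Algebra.smul_def]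
    rfl
  obtain ⟨α, -, hαy⟩ := hS₂.exists_lift S₁ (algebraMap (ZMod 2) S₁) (fun _ i => x i.1 i.2) (by
    intro _ _
    rw [Fintype.prod_sigma]
    simp only [hS₁.prod_eq _ (Finset.mem_univ _)]
    rw [← Polynomial.map_prod, hcprod]
    simp)
  obtain ⟨β, hβA, hβx⟩ := hS₁.exists_lift S₂ φ (fun p i => y ⟨p, i⟩) (fun p _ => (hcφ p).symm)
  have hβα : β.comp α = RingHom.id S₂ := hS₂.hom_ext _ _ _ (Subsingleton.elim _ _)
    fun p hp i => by simp [hαy p hp i, hβx]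
  have hαβ : α.comp β = RingHom.id S₁ := by
    refine hS₁.hom_ext _ _ _ ?_ fun p hp i => by simp [hβx p hp i, hαy]
    refine Ideal.Quotient.ringHom_ext (ringHom_ext_of_betaPoly q n fun p => ?_)
    have hdα : (d p).map α = (c p).map (algebraMap A S₁) := by
      rw [← hS₁.prod_eq p (Finset.mem_univ _), hd]
      simp [Polynomial.map_prod, hαy]
    have e1 : (α.comp β).comp (algebraMap A S₁) = α.comp φ := by rw [RingHom.comp_assoc, hβA]
    rw [e1, RingHom.id_comp, RingHom.comp_assoc, hφmk, ← Polynomial.map_map, hφ₀,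
      Polynomial.palindromicLift_map, hdα, ← Polynomial.palindromicLift_map, hcB, hB,
      Polynomial.map_map]
  let e : S₂ ≃ₗ[ZMod 2] S₁ :=
    (AlgEquiv.ofRingEquiv (f := RingEquiv.ofRingHom α β hαβ hβα) fun r =>
      congr($(Subsingleton.elim (α.comp (algebraMap (ZMod 2) S₂)) (algebraMap (ZMod 2) S₁))
        r)).toLinearEquiv
  exact ⟨S₁, inferInstance, inferInstance, inferInstance, htower, hntA, .equiv e, hfree₁,
    by simpa using hS₁.finrank_eq, e.finrank_eq ▸ hrank₂⟩

/-- `P/(μ̃₁,…,μ̃_h)` is a finite-dimensional `𝔽₂`-vector space of dimension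
`h! / (⌊n₁/2⌋! ⋯ ⌊n_q/2⌋!)`, where `h = ⌊n₁/2⌋ + ⋯ + ⌊n_q/2⌋`. -/
theorem stmt_10 (q : ℕ) (hq : 1 ≤ q) (n : Fin q → ℕ) (hn : ∀ p, 1 ≤ n p) :
    Module.Finite (ZMod 2)
      (MvPolynomial (Σ p : Fin q, Fin (n p / 2)) (ZMod 2) ⧸
        Ideal.span {x | ∃ i, 1 ≤ i ∧ i ≤ ∑ p, n p / 2 ∧ x = muTildeP q n i}) ∧
    Module.finrank (ZMod 2)
      (MvPolynomial (Σ p : Fin q, Fin (n p / 2)) (ZMod 2) ⧸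
        Ideal.span {x | ∃ i, 1 ≤ i ∧ i ≤ ∑ p, n p / 2 ∧ x = muTildeP q n i}) =
      (∑ p, n p / 2).factorial / ∏ p, (n p / 2).factorial := by
  obtain ⟨S, _, _, _, _, hnt, hfin, hfree, hA, hk⟩ := exists_splitting_of_muTildeQuotient q n
  set A := MuTildeQuotient q n
  have hpos : 0 < ∏ p, (n p / 2).factorial := Finset.prod_pos fun p _ => Nat.factorial_pos _
  have : Nontrivial S := Module.nontrivial_of_finrank_pos (R := A) (hA ▸ hpos)
  have hinj : Function.Injective (IsScalarTower.toAlgHom (ZMod 2) A S).toLinearMap :=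
    FaithfulSMul.algebraMap_injective A S
  have : Module.Finite (ZMod 2) A := Module.Finite.of_injective _ hinj
  refine ⟨this, ?_⟩
  rw [← hk, ← Module.finrank_mul_finrank (ZMod 2) A S, hA, Nat.mul_div_cancel _ hpos]
end

section
/- Let m, n₁,…,n_l be positive integers, n := m + n₁ + ⋯ + n_l, and let S be the polynomial ring over 𝔽₂ = ℤ/2 in the indeterminates α₁,…,α_m and β_i^{(p)} for 1 ≤ p ≤ l, 1 ≤ i ≤ ⌊n_p/2⌋. With the conventions α₀ := 1, α_i := α_{2m−i} for m < i ≤ 2m, α_i := 0 for i < 0 or i > 2m, β_0^{(p)} := 1, β_i^{(p)} := β_{n_p−i}^{(p)} for ⌊n_p/2⌋ < i ≤ n_p, β_i^{(p)} := 0 for i < 0 or i > n_p, define μ_j := Σ_{a₁+⋯+a_l = j} β_{a₁}^{(1)}⋯β_{a_l}^{(l)} and ν_k := Σ_{i=0}^{⌊k/2⌋} α_{k−2i}·μ_i + (binom(2n, k) mod 2). Set h' := ⌊m/2⌋ + ⌊n₁/2⌋ + ⋯ + ⌊n_l/2⌋. Then the elements of A₁ ∪ A₂, where A₁ := {ν_i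 : 1 ≤ i ≤ m, i odd} and A₂ := {ν_i : 2 ≤ i ≤ 2h', i even}, form an S-regular sequence in some order. -/
open MvPolynomial

/-- The element `α_i` of the polynomial ring `S` over `𝔽₂` in the indeterminates
`α₁, …, α_m` and `β_i^{(p)}`, with the conventions `α_0 = 1`, `α_i = α_{2m−i}` for
`m < i ≤ 2m`, and `α_i = 0` for `i > 2m`. -/
noncomputable def alS (m l : ℕ) (n : Fin l → ℕ) (i : ℕ) :
    MvPolynomial (Fin m ⊕ Σ p : Fin l, Fin (n p / 2)) (ZMod 2) :=
  if h : i ≤ 2 * m then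
    (if h1 : 1 ≤ min i (2 * m - i) then X (Sum.inl ⟨min i (2 * m - i) - 1, by omega⟩) else 1)
  else 0

/-- The element `β_i^{(p)}` of `S`, with the conventions `β_0^{(p)} = 1`,
`β_i^{(p)} = β_{n_p−i}^{(p)}` for `⌊n_p/2⌋ < i ≤ n_p`, and `β_i^{(p)} = 0` for `i > n_p`. -/
noncomputable def beS (m l : ℕ) (n : Fin l → ℕ) (p : Fin l) (i : ℕ) :
    MvPolynomial (Fin m ⊕ Σ p : Fin l, Fin (n p / 2)) (ZMod 2) :=
  if h : i ≤ n p then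
    (if h1 : 1 ≤ min i (n p - i) then X (Sum.inr ⟨p, ⟨min i (n p - i) - 1, by omega⟩⟩) else 1)
  else 0

/-- `μ_j := Σ_{a₁+⋯+a_l = j} β_{a₁}^{(1)} ⋯ β_{a_l}^{(l)}`. -/
noncomputable def muS (m l : ℕ) (n : Fin l → ℕ) (j : ℕ) :
    MvPolynomial (Fin m ⊕ Σ p : Fin l, Fin (n p / 2)) (ZMod 2) :=
  ∑ a ∈ (Fintype.piFinset fun _ : Fin l => Finset.range (j + 1)).filter
      (fun a => ∑ p, a p = j),
    ∏ p, beS m l n p (a p)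

/-- `ν_k := Σ_{i=0}^{⌊k/2⌋} α_{k−2i}·μ_i + (binom(2n, k) mod 2)`, with
`n = m + n₁ + ⋯ + n_l`. -/
noncomputable def nuS (m l : ℕ) (n : Fin l → ℕ) (k : ℕ) :
    MvPolynomial (Fin m ⊕ Σ p : Fin l, Fin (n p / 2)) (ZMod 2) :=
  (∑ i ∈ Finset.range (k / 2 + 1), alS m l n (k - 2 * i) * muS m l n i) +
    (Nat.choose (2 * (m + ∑ p, n p)) k :
      MvPolynomial (Fin m ⊕ Σ p : Fin l, Fin (n p / 2)) (ZMod 2))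

/-- The subring `B ⊆ S` generated by all the indeterminates `β_i^{(p)}`. -/
noncomputable def Bsub (m l : ℕ) (n : Fin l → ℕ) :
    Subring (MvPolynomial (Fin m ⊕ Σ p : Fin l, Fin (n p / 2)) (ZMod 2)) :=
  Subring.closure (Set.range fun v : Σ p : Fin l, Fin (n p / 2) => X (Sum.inr v))

/-- `l` is a regular sequence on `A ⧸ I`. -/
def RegMod {A : Type*} [CommRing A] : Ideal A → List A → Prop
  | _, [] => True
  | I, a :: l => (∀ x, a * x ∈ I → x ∈ I) ∧ RegMod (I ⊔ Ideal.span {a}) l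

section RegMod

variable {A : Type*} [CommRing A]

lemma regMod_append (I : Ideal A) (l₁ l₂ : List A) :
    RegMod I (l₁ ++ l₂) ↔ RegMod I l₁ ∧ RegMod (I ⊔ Ideal.ofList l₁) l₂ := by
  induction l₁ generalizing I with
  | nil => simp [RegMod]
  | cons a l ih => simp [RegMod, ih, Ideal.ofList_cons, sup_assoc, and_assoc]

lemma RegMod.isRegularSeq {l : List A} (h : RegMod ⊥ l) : IsRegularSeq l := by
  intro i hi x hx
  have hl : l = l.take i ++ (l.get ⟨i, hi⟩ :: l.drop (i + 1)) := by simp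
  rw [hl, regMod_append, bot_sup_eq] at h
  exact h.2.1 x hx

lemma regMod_congr_sub {I : Ideal A} {a b : A} {l : List A} (hab : a - b ∈ I)
    (h : RegMod I (b :: l)) : RegMod I (a :: l) := by
  refine ⟨fun x hx => h.1 x ?_, ?_⟩
  · have := I.sub_mem hx (I.mul_mem_right x hab)
    rwa [← sub_mul, sub_sub_cancel] at this
  · have hI : I ⊔ Ideal.span {a} = I ⊔ Ideal.span {b} := by
      refine le_antisymm (sup_le le_sup_left ?_) (sup_le le_sup_left ?_) <;>
        rw [Ideal.span_singleton_le_iff_mem]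
      · rw [← sub_add_cancel a b]
        exact Ideal.add_mem _ (Ideal.mem_sup_left hab)
          (Ideal.mem_sup_right (Ideal.mem_span_singleton_self b))
      · rw [← sub_sub_cancel a b]
        exact Ideal.sub_mem _ (Ideal.mem_sup_right (Ideal.mem_span_singleton_self a))
          (Ideal.mem_sup_left hab)
    rw [hI]
    exact h.2

/-- A unitriangular change of the initial segment of a sequence preserves regularity. -/
lemma regMod_map_range_append {I : Ideal A} {f g : ℕ → A} {n : ℕ}
    (hfg : ∀ i < n, f i - g i ∈ I ⊔ Ideal.ofList ((List.range i).map g)) {l : List A}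
    (h : RegMod I ((List.range n).map g ++ l)) : RegMod I ((List.range n).map f ++ l) := by
  induction n generalizing l with
  | zero => simpa using h
  | succ n ih =>
    rw [List.range_succ, List.map_append, List.append_assoc] at h ⊢
    refine ih (fun i hi => hfg i (hi.trans n.lt_succ_self)) ?_
    rw [regMod_append] at h ⊢
    exact ⟨h.1, regMod_congr_sub (hfg n n.lt_succ_self) h.2⟩

lemma mem_ofList_map_range {g : ℕ → A} {i j : ℕ} (h : i < j) :
    g i ∈ Ideal.ofList ((List.range j).map g) :=
  Ideal.subset_span (List.mem_map_of_mem (List.mem_range.2 h))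

namespace Polynomial

lemma mem_map_C_sup_span_iff {g : A[X]} (hg : g.Monic) (J : Ideal A) (p : A[X]) :
    p ∈ J.map C ⊔ Ideal.span {g} ↔ ∀ i, (p %ₘ g).coeff i ∈ J := by
  rw [← Ideal.mem_map_C_iff]
  constructor
  · intro hp
    obtain ⟨y, hy, z, hz, rfl⟩ := Submodule.mem_sup.1 hp
    obtain ⟨w, rfl⟩ := Ideal.mem_span_singleton.1 hz
    rw [add_modByMonic, (modByMonic_eq_zero_iff_dvd hg).2 (dvd_mul_right g w), add_zero]
    rw [Ideal.mem_map_C_iff] at hy ⊢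
    have hy' : y.map (Ideal.Quotient.mk J) = 0 := by
      ext i
      rw [coeff_map, coeff_zero, Ideal.Quotient.eq_zero_iff_mem]
      exact hy i
    intro i
    rw [← Ideal.Quotient.eq_zero_iff_mem, ← coeff_map, map_modByMonic _ hg, hy', zero_modByMonic,
      coeff_zero]
  · intro hp
    rw [← modByMonic_add_div p g]
    exact Ideal.add_mem _ (Ideal.mem_sup_left hp)
      (Ideal.mem_sup_right (Ideal.mul_mem_right _ _ (Ideal.mem_span_singleton_self g)))

lemma regMod_cons_map_C {g : A[X]} (hg : g.Monic) {l : List A} (h : RegMod ⊥ l) :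
    RegMod ⊥ (g :: l.map C) := by
  refine ⟨fun x hx => ?_, ?_⟩
  · rw [Ideal.mem_bot] at hx ⊢
    exact (hg.mul_right_eq_zero_iff).1 hx
  suffices H : ∀ J : Ideal A, RegMod J l → RegMod (J.map C ⊔ Ideal.span {g}) (l.map C) by
    simpa using H ⊥ h
  clear h
  induction l with
  | nil => simp [RegMod]
  | cons a l ih =>
    rintro J ⟨h1, h2⟩
    refine ⟨fun x hx => ?_, ?_⟩
    · rw [mem_map_C_sup_span_iff hg] at hx ⊢
      intro i
      have := hx i
      rw [← smul_eq_C_mul, smul_modByMonic, coeff_smul] at this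
      exact h1 _ this
    · have := ih _ h2
      rwa [Ideal.map_sup, Ideal.map_span, Set.image_singleton, sup_right_comm] at this

end Polynomial

end RegMod

namespace Polynomial

section Quad

variable {R : Type*} [CommRing R]

/-- The palindromic quadratic polynomial `1 + x X + X²`. -/
noncomputable def quad (x : R) : R[X] := 1 + C x * X + X ^ 2

lemma coeff_quad_mul_zero (x : R) (p : R[X]) : (quad x * p).coeff 0 = p.coeff 0 := by
  simp [quad, mul_coeff_zero]

lemma coeff_quad_mul_one (x : R) (p : R[X]) :
    (quad x * p).coeff 1 = p.coeff 1 + x * p.coeff 0 := by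
  have : quad x * p = p + C x * (p * X) + p * X ^ 2 := by rw [quad]; ring
  rw [this, coeff_add, coeff_add, coeff_C_mul, coeff_mul_X p 0, coeff_mul_X_pow']
  simp

lemma coeff_quad_mul_add_two (x : R) (p : R[X]) (i : ℕ) :
    (quad x * p).coeff (i + 2) = p.coeff (i + 2) + x * p.coeff (i + 1) + p.coeff i := by
  have : quad x * p = p + C x * (p * X) + p * X ^ 2 := by rw [quad]; ring
  rw [this, coeff_add, coeff_add, coeff_C_mul, coeff_mul_X p (i + 1), coeff_mul_X_pow]

lemma map_quad {S : Type*} [CommRing S] (f : R →+* S) (x : R) :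
    (quad x).map f = quad (f x) := by
  simp [quad]

/-- In characteristic two, the coefficients of the power series `(∑ b_i X ^ i) / quad x`. -/
def divQuad (b : ℕ → R) (x : R) : ℕ → R
  | 0 => b 0
  | 1 => b 1 + x * b 0
  | i + 2 => b (i + 2) + x * divQuad b x (i + 1) + divQuad b x i

lemma map_divQuad {S : Type*} [CommRing S] (f : R →+* S) (b : ℕ → R) (x : R) (i : ℕ) :
    f (divQuad b x i) = divQuad (fun j => f (b j)) (f x) i := by
  induction i using Nat.twoStepInduction with
  | zero => rfl
  | one => simp [divQuad]
  | more i h0 h1 => simp [divQuad, h0, h1]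

lemma divQuad_natDegree_coeff {b : ℕ → R} (hb : b 0 = 1) (i : ℕ) :
    (divQuad (fun j => C (b j)) X i).natDegree ≤ i ∧
      (divQuad (fun j => C (b j)) X i).coeff i = 1 := by
  induction i using Nat.twoStepInduction with
  | zero => simp [divQuad, hb]
  | one =>
    simp only [divQuad, hb]
    constructor
    · compute_degree
    · simp
  | more i h0 h1 =>
    simp only [divQuad]
    constructor
    · refine natDegree_add_le_of_degree_le (natDegree_add_le_of_degree_le (by simp) ?_)
        (h0.1.trans (by omega))
      refine natDegree_mul_le.trans ?_
      have := natDegree_X_le (R := R)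
      omega
    · rw [coeff_add, coeff_add, coeff_C_succ, coeff_X_mul, h1.2,
        coeff_eq_zero_of_natDegree_lt (h0.1.trans_lt (by omega))]
      simp

/-- In characteristic two, the monic polynomial in `x` whose vanishing is the condition for
`quad x` to divide a palindromic polynomial of degree `2 n + 2` with coefficients `b`. -/
noncomputable def quadResidue (b : ℕ → R) (n : ℕ) : R[X] :=
  X * divQuad (fun j => C (b j)) X n + C (b (n + 1))

lemma quadResidue_natDegree_coeff {b : ℕ → R} (hb : b 0 = 1) (n : ℕ) :
    (quadResidue b n).natDegree ≤ n + 1 ∧ (quadResidue b n).coeff (n + 1) = 1 := by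
  obtain ⟨h1, h2⟩ := divQuad_natDegree_coeff hb n
  constructor
  · refine natDegree_add_le_of_degree_le (natDegree_mul_le.trans ?_) (by simp)
    have := natDegree_X_le (R := R)
    omega
  · simp [quadResidue, coeff_X_mul, h2, coeff_C_succ]

lemma monic_quadResidue {b : ℕ → R} (hb : b 0 = 1) (n : ℕ) : (quadResidue b n).Monic :=
  monic_of_natDegree_le_of_coeff_eq_one _ (quadResidue_natDegree_coeff hb n).1
    (quadResidue_natDegree_coeff hb n).2

/-- `p` is palindromic with respect to the formal degree `d`. -/
def IsPal (d : ℕ) (p : R[X]) : Prop := p.natDegree ≤ d ∧ p.reflect d = p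

lemma isPal_of_coeff {d : ℕ} {p : R[X]} (h : p.natDegree ≤ d)
    (h' : ∀ i ≤ d, p.coeff (d - i) = p.coeff i) : IsPal d p := by
  refine ⟨h, ext fun i => ?_⟩
  rw [coeff_reflect]
  rcases le_or_gt i d with hi | hi
  · rw [revAt_le hi, h' i hi]
  · rw [revAt_eq_self_of_lt hi]

namespace IsPal

variable {d d' : ℕ} {p q : R[X]}

lemma coeff_sub (h : IsPal d p) {i : ℕ} (hi : i ≤ d) : p.coeff (d - i) = p.coeff i := by
  rw [← revAt_le hi, ← coeff_reflect, h.2]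

lemma coeff_min (h : IsPal d p) {i : ℕ} (hi : i ≤ d) :
    p.coeff (min i (d - i)) = p.coeff i := by
  rcases min_choice i (d - i) with h' | h' <;> rw [h']
  exact h.coeff_sub hi

lemma one : IsPal 0 (1 : R[X]) := isPal_of_coeff (by simp) (by simp)

lemma mul (hp : IsPal d p) (hq : IsPal d' q) : IsPal (d + d') (p * q) :=
  ⟨natDegree_mul_le.trans (add_le_add hp.1 hq.1), by rw [reflect_mul _ _ hp.1 hq.1, hp.2, hq.2]⟩

lemma prod {ι : Type*} (s : Finset ι) {d : ι → ℕ} {p : ι → R[X]} (h : ∀ i ∈ s, IsPal (d i) (p i)) :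
    IsPal (∑ i ∈ s, d i) (∏ i ∈ s, p i) := by
  classical
  induction s using Finset.induction_on with
  | empty => simpa using one
  | insert a s ha ih =>
    rw [Finset.sum_insert ha, Finset.prod_insert ha]
    exact (h a (Finset.mem_insert_self a s)).mul
      (ih fun i hi => h i (Finset.mem_insert_of_mem hi))

lemma quad (x : R) : IsPal 2 (quad x) := by
  refine isPal_of_coeff (by rw [Polynomial.quad]; compute_degree) fun i hi => ?_
  interval_cases i <;> simp [Polynomial.quad, coeff_X, coeff_one]

lemma prod_quad {n : ℕ} (x : Fin n → R) : IsPal (2 * n) (∏ i, Polynomial.quad (x i)) := by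
  simpa [mul_comm] using prod Finset.univ fun i _ => quad (x i)

lemma one_add_X : IsPal 1 (1 + X : R[X]) := by
  refine isPal_of_coeff (by compute_degree) fun i hi => ?_
  interval_cases i <;> simp [coeff_X, coeff_one]

lemma one_add_X_pow (d : ℕ) : IsPal d ((1 + X : R[X]) ^ d) := by
  simpa using prod (Finset.range d) fun _ _ => one_add_X (R := R)

lemma map {S : Type*} [CommRing S] (f : R →+* S) (h : IsPal d p) : IsPal d (p.map f) :=
  ⟨natDegree_map_le.trans h.1, by rw [reflect_map, h.2]⟩

lemma ext (hp : IsPal d p) (hq : IsPal d q)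
    (h : ∀ i ≤ d / 2, p.coeff i = q.coeff i) : p = q := by
  ext i
  rcases le_or_gt i d with hi | hi
  · rw [← hp.coeff_min hi, ← hq.coeff_min hi]
    exact h _ (by omega)
  · rw [coeff_eq_zero_of_natDegree_lt (hp.1.trans_lt hi),
      coeff_eq_zero_of_natDegree_lt (hq.1.trans_lt hi)]

end IsPal

lemma coeff_zero_prod_quad {n : ℕ} (x : Fin n → R) : (∏ i, quad (x i)).coeff 0 = 1 := by
  rw [coeff_zero_prod]
  exact Finset.prod_eq_one fun i _ => by simp [quad]

/-- The universal ring over `B` in which `n` elements are adjoined, together with the regularity of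
the sequence of coefficients of the product of the associated quadratic polynomials, shifted by
constants. -/
theorem exists_universal_regMod (n : ℕ) : ∀ (B : Type) [CommRing B], (2 : B) = 0 →
    ∀ l : List B, RegMod ⊥ l → ∀ b : ℕ → B, b 0 = 1 →
    ∃ (T : Type) (_ : CommRing T) (f : B →+* T) (x : Fin n → T),
      (∀ (U : Type) [CommRing U] (g : B →+* U) (y : Fin n → U),
        ∃ φ : T →+* U, φ.comp f = g ∧ ∀ i, φ (x i) = y i) ∧
      RegMod ⊥ ((List.range n).map
        (fun i => (∏ j, quad (x j)).coeff (i + 1) - f (b (i + 1))) ++ l.map f) := by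
  induction n with
  | zero =>
    intro B _ _ l hl b _
    exact ⟨B, inferInstance, RingHom.id B, Fin.elim0,
      fun U _ g y => ⟨g, RingHom.comp_id g, fun i => i.elim0⟩, by simpa using hl⟩
  | succ n ih =>
    intro B _ h2 l hl b hb
    have h2' : (2 : B[X]) = 0 := by rw [← C_ofNat, h2, C_0]
    obtain ⟨T, _, f, x, hT, hreg⟩ := ih B[X] h2' (quadResidue b n :: l.map C)
      (regMod_cons_map_C (monic_quadResidue hb n) hl) (divQuad (fun j => C (b j)) X)
      (by simp [divQuad, hb])
    have h2T : (2 : T) = 0 := by rw [← map_ofNat f, h2', map_zero]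
    refine ⟨T, inferInstance, f.comp C, Fin.cons (f X) x, ?_, ?_⟩
    · intro U _ g y
      obtain ⟨φ, h1, h2⟩ := hT U (eval₂RingHom g (y 0)) (Fin.tail y)
      refine ⟨φ, ?_, ?_⟩
      · rw [← RingHom.comp_assoc, h1]
        ext; simp
      · intro i
        refine Fin.cases ?_ (fun i => ?_) i
        · rw [Fin.cons_zero, ← RingHom.comp_apply, h1]
          simp
        · rw [Fin.cons_succ, h2, Fin.tail]
    · rw [List.range_succ, List.map_append, List.append_assoc]
      have hpal := IsPal.prod_quad x
      have h0 := coeff_zero_prod_quad x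
      simp only [Fin.prod_univ_succ, Fin.cons_zero, Fin.cons_succ, RingHom.comp_apply]
      set E := ∏ j, quad (x j)
      set c : ℕ → B[X] := divQuad (fun j => C (b j)) X with hc
      have hc0 : E.coeff 0 - f (c 0) = 0 := by simp [h0, hc, divQuad, hb]
      have hmem : ∀ {i j}, i ≤ j → E.coeff i - f (c i) ∈ Ideal.ofList
          ((List.range j).map fun i => E.coeff (i + 1) - f (c (i + 1))) := by
        intro i j hij
        cases i with
        | zero => rw [hc0]; exact Ideal.zero_mem _
        | succ i => exact mem_ofList_map_range (g := fun i => E.coeff (i + 1) - f (c (i + 1))) hij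
      have key : ∀ i, (quad (f X) * E).coeff (i + 1) - f (C (b (i + 1))) -
          (E.coeff (i + 1) - f (c (i + 1))) ∈ Ideal.ofList
          ((List.range i).map fun i => E.coeff (i + 1) - f (c (i + 1))) := by
        intro i
        cases i with
        | zero =>
          rw [coeff_quad_mul_one]
          convert Ideal.zero_mem _
          simp [h0, hc, divQuad, hb]
          linear_combination f X * h2T
        | succ i =>
          rw [coeff_quad_mul_add_two]
          have hci : f (c (i + 2)) = f (C (b (i + 2))) + f X * f (c (i + 1)) + f (c i) := by
            simp [hc, divQuad]
          convert Ideal.add_mem _ (Ideal.mul_mem_left _ (f X) (hmem le_rfl)) (hmem i.le_succ)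
            using 1
          linear_combination hci + (f X * f (c (i + 1)) + f (c i)) * h2T
      refine regMod_map_range_append (fun i _ => Ideal.mem_sup_right (key i)) ?_
      rw [regMod_append, bot_sup_eq] at hreg ⊢
      refine ⟨hreg.1, regMod_congr_sub ?_ (by simpa using hreg.2)⟩
      have hlast : (quad (f X) * E).coeff (n + 1) = f X * E.coeff n := by
        cases n with
        | zero =>
          rw [coeff_quad_mul_one, coeff_eq_zero_of_natDegree_lt (hpal.1.trans_lt (by omega)),
            zero_add]
        | succ n =>
          rw [coeff_quad_mul_add_two, ← hpal.coeff_sub (i := n) (by omega),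
            show 2 * (n + 1) - n = n + 2 by omega]
          linear_combination E.coeff (n + 2) * h2T
      simp only [hlast, quadResidue, ← hc]
      convert Ideal.mul_mem_left _ (f X) (hmem (le_refl n)) using 1
      rw [map_add, map_mul]
      linear_combination -f (C (b (n + 1))) * h2T

end Quad

end Polynomial

/-- The ring homomorphism `f : A → U` admits an `A`-linear retraction. -/
def HasRetraction {A U : Type*} [CommRing A] [CommRing U] (f : A →+* U) : Prop :=
  ∃ ρ : U →+ A, ρ 1 = 1 ∧ ∀ a u, ρ (f a * u) = a * ρ u

namespace HasRetraction

variable {A U V : Type*} [CommRing A] [CommRing U] [CommRing V] {f : A →+* U} {g : U →+* V}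

lemma id : HasRetraction (RingHom.id A) := ⟨AddMonoidHom.id A, rfl, fun _ _ => rfl⟩

lemma comp (hg : HasRetraction g) (hf : HasRetraction f) : HasRetraction (g.comp f) := by
  obtain ⟨ρ, h1, h2⟩ := hf
  obtain ⟨σ, h3, h4⟩ := hg
  exact ⟨ρ.comp σ, by simp [h1, h3], fun a u => by simp [h2, h4]⟩

lemma mem_of_map_mem (hf : HasRetraction f) {I : Ideal A} {x : A} (hx : f x ∈ I.map f) :
    x ∈ I := by
  obtain ⟨ρ, h1, h2⟩ := hf
  have key : ∀ y ∈ I.map f, ρ y ∈ I := by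
    intro y hy
    suffices h : ∀ u, ρ (u * y) ∈ I by simpa using h 1
    refine Submodule.span_induction (p := fun y _ => ∀ u, ρ (u * y) ∈ I) ?_ ?_ ?_ ?_ hy
    · rintro _ ⟨a, ha, rfl⟩ u
      rw [mul_comm, h2]
      exact I.mul_mem_right _ ha
    · simp
    · intro y z _ _ hy hz u
      rw [mul_add, map_add]
      exact I.add_mem (hy u) (hz u)
    · intro a y _ hy u
      rw [smul_eq_mul, ← mul_assoc]
      exact hy _
  have := key _ hx
  rwa [← mul_one (f x), h2, h1, mul_one] at this

lemma isRegularSeq {T : Type*} [CommRing T] {φ : A →+* T} {ψ : T →+* U}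
    (hf : HasRetraction (ψ.comp φ)) {l : List A} (hl : IsRegularSeq (l.map φ)) :
    IsRegularSeq l := by
  intro i hi x hx
  have hmap : Ideal.span {y | y ∈ (l.map φ).take i} = (Ideal.span {y | y ∈ l.take i}).map φ := by
    rw [← List.map_take]
    exact (Ideal.map_ofList φ _).symm
  have h := hl i (by simpa using hi) (φ x)
  rw [hmap] at h
  refine hf.mem_of_map_mem ?_
  rw [← Ideal.map_map]
  refine Ideal.mem_map_of_mem ψ (h ?_)
  have := Ideal.mem_map_of_mem φ hx
  simpa using this

end HasRetraction

namespace Polynomial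

section Split

lemma hasRetraction_of_monic {A : Type*} [CommRing A] {g : A[X]} (hg : g.Monic)
    (hd : 0 < g.natDegree) : HasRetraction (AdjoinRoot.of g) := by
  refine ⟨((lcoeff A 0).comp (AdjoinRoot.modByMonicHom hg)).toAddMonoidHom, ?_, fun a u => ?_⟩
  · have : Nontrivial A := by
      by_contra h
      rw [not_nontrivial_iff_subsingleton] at h
      rw [Subsingleton.elim g 0] at hd
      simp at hd
    have h1 : (1 : A[X]) %ₘ g = 1 := (modByMonic_eq_self_iff hg).2 (by
      rw [degree_one]; exact natDegree_pos_iff_degree_pos.1 hd)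
    have := AdjoinRoot.modByMonicHom_mk hg 1
    simp only [map_one] at this
    simp [this, h1]
  · have : AdjoinRoot.of g a * u = a • u := by
      rw [Algebra.smul_def, AdjoinRoot.algebraMap_eq]
    simp [this]

theorem exists_eq_prod_quad (n : ℕ) : ∀ (A : Type) [CommRing A], (2 : A) = 0 →
    ∀ p : A[X], IsPal (2 * n) p → p.coeff 0 = 1 →
    ∃ (U : Type) (_ : CommRing U) (f : A →+* U) (y : Fin n → U),
      HasRetraction f ∧ p.map f = ∏ i, quad (y i) := by
  induction n with
  | zero =>
    intro A _ _ p hp hp0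
    refine ⟨A, inferInstance, RingHom.id A, Fin.elim0, HasRetraction.id, ?_⟩
    rw [map_id, Finset.univ_eq_empty, Finset.prod_empty]
    exact hp.ext IsPal.one fun i hi => by simp [Nat.le_zero.1 (show i ≤ 0 from hi), hp0]
  | succ n ih =>
    intro A _ h2 p hp hp0
    rcases subsingleton_or_nontrivial A with hA | hA
    · exact ⟨A, inferInstance, RingHom.id A, 0, HasRetraction.id, Subsingleton.elim _ _⟩
    set g := quadResidue p.coeff n with hg
    have hgm : g.Monic := monic_quadResidue hp0 n
    have hgd : 0 < g.natDegree := by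
      refine n.succ_pos.trans_le (le_natDegree_of_ne_zero ?_)
      rw [hg, (quadResidue_natDegree_coeff hp0 n).2]
      exact one_ne_zero
    set f := AdjoinRoot.of g
    set x := AdjoinRoot.root g with hx
    have h2' : (2 : AdjoinRoot g) = 0 := by rw [← map_ofNat f, h2, map_zero]
    set c : ℕ → AdjoinRoot g := divQuad (fun j => f (p.coeff j)) x with hc
    have hcn : x * c n + f (p.coeff (n + 1)) = 0 := by
      have hroot : (quadResidue p.coeff n).eval₂ f x = 0 := AdjoinRoot.eval₂_root g
      rw [quadResidue, eval₂_add, eval₂_mul, eval₂_X, eval₂_C] at hroot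
      rw [← hroot, hc]
      congr 2
      have h := map_divQuad (eval₂RingHom f x) (fun j => C (p.coeff j)) X n
      simp only [coe_eval₂RingHom, eval₂_C, eval₂_X] at h
      exact h.symm
    set G : (AdjoinRoot g)[X] :=
      ∑ i ∈ Finset.range (2 * n + 1), C (c (min i (2 * n - i))) * X ^ i with hG
    have hGc : ∀ i, G.coeff i = if i < 2 * n + 1 then c (min i (2 * n - i)) else 0 := by
      intro i
      simp [hG, coeff_X_pow]
    have hGpal : IsPal (2 * n) G := by
      refine isPal_of_coeff (natDegree_sum_le_of_forall_le _ _ fun i hi => ?_) fun i hi => ?_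
      · exact (natDegree_C_mul_X_pow_le _ _).trans (Nat.lt_succ_iff.1 (Finset.mem_range.1 hi))
      · rw [hGc, hGc, if_pos (by omega), if_pos (by omega)]
        congr 1
        omega
    have hGle : ∀ i ≤ n, G.coeff i = c i := by
      intro i hi
      rw [hGc, if_pos (by omega), min_eq_left (by omega)]
    have hfac : p.map f = quad x * G := by
      refine (hp.map f).ext (d := 2 * (n + 1))
        (by convert (IsPal.quad x).mul hGpal using 1; ring) fun i hi => ?_
      rw [coeff_map]
      rcases Nat.lt_or_ge n i with h | h
      · obtain rfl : i = n + 1 := by omega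
        have : (quad x * G).coeff (n + 1) = x * G.coeff n := by
          cases n with
          | zero =>
            rw [coeff_quad_mul_one, hGc 1, if_neg (by omega), zero_add]
          | succ n =>
            rw [coeff_quad_mul_add_two, ← hGpal.coeff_sub (i := n) (by omega),
              show 2 * (n + 1) - n = n + 2 by omega]
            linear_combination G.coeff (n + 2) * h2'
        rw [this, hGle n le_rfl]
        linear_combination hcn - x * c n * h2'
      · match i with
        | 0 => rw [coeff_quad_mul_zero, hGle 0 h]; rfl
        | 1 =>
          rw [coeff_quad_mul_one, hGle 0 (by omega), hGle 1 h]
          simp only [hc, divQuad]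
          linear_combination -x * f (p.coeff 0) * h2'
        | i + 2 =>
          rw [coeff_quad_mul_add_two, hGle _ h, hGle _ (by omega), hGle _ (by omega)]
          have : c (i + 2) = f (p.coeff (i + 2)) + x * c (i + 1) + c i := rfl
          linear_combination -this - (x * c (i + 1) + c i) * h2'
    obtain ⟨U, _, f', y, hf', hy⟩ := ih _ h2' G hGpal (by
      rw [hGle 0 n.zero_le]; simp [hc, divQuad, hp0])
    refine ⟨U, inferInstance, f'.comp f, Fin.cons (f' x) y,
      hf'.comp (hasRetraction_of_monic hgm hgd), ?_⟩
    rw [← map_map, hfac, Polynomial.map_mul, hy, map_quad, Fin.prod_univ_succ]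
    simp

lemma IsPal.exists_eq_one_add_X_mul {A : Type*} [CommRing A] (h2 : (2 : A) = 0) {n : ℕ} {p : A[X]}
    (hp : IsPal (2 * n + 1) p) : ∃ q, IsPal (2 * n) q ∧ p = (1 + X) * q := by
  have hX : (1 + X : A[X]) = X - C 1 := by
    have : (2 : A[X]) = 0 := by rw [← C_ofNat, h2, C_0]
    rw [C_1]
    linear_combination this
  have heval : p.eval 1 = 0 := by
    rw [eval_eq_sum_range' (n := (n + 1) + (n + 1)) (by have := hp.1; omega), Finset.sum_range_add,
      ← Finset.sum_range_reflect (fun i => p.coeff (n + 1 + i) * _), ← Finset.sum_add_distrib]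
    refine Finset.sum_eq_zero fun i hi => ?_
    have hi' := Finset.mem_range.1 hi
    rw [← hp.coeff_sub (i := i) (by omega),
      show n + 1 + (n + 1 - 1 - i) = 2 * n + 1 - i by omega]
    simp only [one_pow]
    linear_combination p.coeff (2 * n + 1 - i) * h2
  obtain ⟨q, rfl⟩ := dvd_iff_isRoot.2 heval
  have hm : (X - C 1 : A[X]).Monic := monic_X_sub_C 1
  have hq : q.natDegree ≤ 2 * n := by
    rcases eq_or_ne q 0 with rfl | hq
    · simp
    have : Nontrivial A := by
      by_contra h
      rw [not_nontrivial_iff_subsingleton] at h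
      exact hq (Subsingleton.elim _ _)
    have := hp.1
    rw [hm.natDegree_mul' hq, natDegree_X_sub_C] at this
    omega
  refine ⟨q, ⟨hq, hm.isRegular.left ?_⟩, by rw [hX]⟩
  have h1 := (IsPal.one_add_X (R := A))
  have h := hp.2
  rw [← hX, add_comm (2 * n), reflect_mul _ _ h1.1 hq, h1.2] at h
  simpa only [← hX] using h

theorem exists_eq_one_add_X_pow_mul_prod_quad {A : Type} [CommRing A] (h2 : (2 : A) = 0)
    {d : ℕ} {p : A[X]} (hp : IsPal d p) (hp0 : p.coeff 0 = 1) :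
    ∃ (U : Type) (_ : CommRing U) (f : A →+* U) (y : Fin (d / 2) → U),
      HasRetraction f ∧ p.map f = (1 + X) ^ (d % 2) * ∏ i, quad (y i) := by
  obtain ⟨q, hq, hpq⟩ : ∃ q, IsPal (2 * (d / 2)) q ∧ p = (1 + X) ^ (d % 2) * q := by
    rcases Nat.mod_two_eq_zero_or_one d with h | h
    · refine ⟨p, ?_, by simp [h]⟩
      rwa [show 2 * (d / 2) = d by omega]
    · rw [h, pow_one]
      exact IsPal.exists_eq_one_add_X_mul h2 (by rwa [show 2 * (d / 2) + 1 = d by omega])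
  obtain ⟨U, _, f, y, hf, hy⟩ := exists_eq_prod_quad (d / 2) A h2 q hq (by
    rw [hpq, mul_coeff_zero] at hp0
    simpa [coeff_zero_eq_eval_zero] using hp0)
  exact ⟨U, inferInstance, f, y, hf, by rw [hpq, Polynomial.map_mul, hy]; simp⟩

theorem exists_forall_eq_one_add_X_pow_mul_prod_quad {ι : Type*} (s : Finset ι)
    {A : Type} [CommRing A] (h2 : (2 : A) = 0) {d : ι → ℕ} {p : ι → A[X]}
    (hp : ∀ i, IsPal (d i) (p i)) (hp0 : ∀ i, (p i).coeff 0 = 1) :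
    ∃ (U : Type) (_ : CommRing U) (f : A →+* U), HasRetraction f ∧
      ∀ i ∈ s, ∃ y : Fin (d i / 2) → U,
        (p i).map f = (1 + X) ^ (d i % 2) * ∏ j, quad (y j) := by
  classical
  induction s using Finset.induction_on with
  | empty => exact ⟨A, inferInstance, RingHom.id A, HasRetraction.id, by simp⟩
  | insert a s ha ih =>
    obtain ⟨U, _, f, hf, hU⟩ := ih
    obtain ⟨V, _, g, y, hg, hV⟩ := exists_eq_one_add_X_pow_mul_prod_quad
      (by rw [← map_ofNat f, h2, map_zero]) ((hp a).map f) (by rw [coeff_map, hp0, map_one])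
    refine ⟨V, inferInstance, g.comp f, hg.comp hf, fun i hi => ?_⟩
    rcases Finset.mem_insert.1 hi with rfl | hi
    · exact ⟨y, by rw [← map_map, hV]⟩
    · obtain ⟨z, hz⟩ := hU i hi
      refine ⟨fun j => g (z j), ?_⟩
      rw [← map_map, hz, Polynomial.map_mul, Polynomial.map_prod]
      simp [map_quad]

end Split

/-- A ring of characteristic two in which `k` universal elements are adjoined; they form a regular
sequence. -/
theorem exists_universal_regMod_ofFn (k : ℕ) :
    ∃ (B : Type) (_ : CommRing B) (z : Fin k → B), (2 : B) = 0 ∧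
      (∀ (U : Type) [CommRing U], (2 : U) = 0 → ∀ y : Fin k → U,
        ∃ φ : B →+* U, ∀ i, φ (z i) = y i) ∧
      RegMod ⊥ (List.ofFn z) := by
  induction k with
  | zero =>
    refine ⟨ZMod 2, inferInstance, Fin.elim0, rfl, fun U _ h2 y => ?_, by simp [RegMod]⟩
    have := ringChar.charP U
    exact ⟨ZMod.castHom ((ringChar.spec U 2).1 (by exact_mod_cast h2)) U, fun i => i.elim0⟩
  | succ k ih =>
    obtain ⟨B, _, z, h2, hB, hreg⟩ := ih
    refine ⟨B[X], inferInstance, Fin.cons X fun i => C (z i), by rw [← C_ofNat, h2, C_0],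
      fun U _ h2U y => ?_, ?_⟩
    · obtain ⟨φ, hφ⟩ := hB U h2U (Fin.tail y)
      refine ⟨eval₂RingHom φ (y 0), fun i => ?_⟩
      refine Fin.cases (by simp) (fun i => ?_) i
      simp [hφ, Fin.tail]
    · have := regMod_cons_map_C monic_X hreg
      rw [List.map_ofFn] at this
      simpa [List.ofFn_succ, Function.comp_def] using this

end Polynomial

lemma Polynomial.coeff_prod_eq_sum_piFinset {R : Type*} [CommRing R] {l : ℕ}
    (F : Fin l → Polynomial R) (j : ℕ) :
    (∏ p, F p).coeff j =
      ∑ a ∈ (Fintype.piFinset fun _ : Fin l => Finset.range (j + 1)).filter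
        (fun a => ∑ p, a p = j), ∏ p, (F p).coeff (a p) := by
  have h : (∏ p, F p).coeff j = PowerSeries.coeff j (∏ p, (F p : PowerSeries R)) := by
    rw [← Polynomial.coeff_coe]
    congr 1
    exact map_prod Polynomial.coeToPowerSeries.ringHom F Finset.univ
  rw [h, PowerSeries.coeff_prod]
  refine Finset.sum_bij' (fun a _ => (a : Fin l → ℕ))
    (fun a _ => Finsupp.equivFunOnFinite.symm a) ?_ ?_ ?_ ?_ ?_
  · intro a ha
    have ha' : ∑ p, a p = j := (Finset.mem_finsuppAntidiag.1 ha).1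
    simp only [Finset.mem_filter, Fintype.mem_piFinset, Finset.mem_range]
    refine ⟨fun p => Nat.lt_succ_of_le ?_, ha'⟩
    rw [← ha']
    exact Finset.single_le_sum (f := a) (fun _ _ => Nat.zero_le _) (Finset.mem_univ p)
  · intro a ha
    rw [Finset.mem_finsuppAntidiag]
    exact ⟨(Finset.mem_filter.1 ha).2, Finset.subset_univ _⟩
  · intro a _
    ext; rfl
  · intro a _
    rfl
  · intro a _
    simp

lemma natCast_eq_of_modEq_two {R : Type*} [CommRing R] (h2 : (2 : R) = 0) {a b : ℕ}
    (h : a ≡ b [MOD 2]) : (a : R) = b := by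
  rw [← Nat.mod_add_div a 2, ← Nat.mod_add_div b 2, h]
  simp [h2]

lemma natCast_choose_two_mul_two_mul {R : Type*} [CommRing R] (h2 : (2 : R) = 0) (n k : ℕ) :
    ((2 * n).choose (2 * k) : R) = n.choose k :=
  natCast_eq_of_modEq_two h2 <| by
    simpa using Choose.choose_modEq_choose_mod_mul_choose_div_nat (p := 2) (n := 2 * n) (k := 2 * k)

lemma natCast_choose_two_mul_two_mul_add_one {R : Type*} [CommRing R] (h2 : (2 : R) = 0)
    (n k : ℕ) : ((2 * n).choose (2 * k + 1) : R) = 0 := by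
  rw [← Nat.cast_zero]
  refine natCast_eq_of_modEq_two h2 ?_
  simpa [Nat.add_mod] using
    Choose.choose_modEq_choose_mod_mul_choose_div_nat (p := 2) (n := 2 * n) (k := 2 * k + 1)

section Indeterminates

variable {m l : ℕ} {n : Fin l → ℕ}

lemma alS_two_mul_sub {i : ℕ} (hi : i ≤ 2 * m) : alS m l n (2 * m - i) = alS m l n i := by
  have h : min (2 * m - i) (2 * m - (2 * m - i)) = min i (2 * m - i) := by omega
  simp only [alS, h, dif_pos hi, dif_pos (Nat.sub_le (2 * m) i)]

lemma beS_sub {p : Fin l} {i : ℕ} (hi : i ≤ n p) : beS m l n p (n p - i) = beS m l n p i := by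
  have h : min (n p - i) (n p - (n p - i)) = min i (n p - i) := by omega
  simp only [beS, h, dif_pos hi, dif_pos (Nat.sub_le (n p) i)]

lemma alS_zero : alS m l n 0 = 1 := by simp [alS]

lemma beS_zero (p : Fin l) : beS m l n p 0 = 1 := by simp [beS]

lemma X_inl_eq_alS (i : Fin m) : X (Sum.inl i) = alS m l n (i + 1) := by
  have := i.2
  have h : min (i.1 + 1) (2 * m - (i + 1)) = i + 1 := by omega
  simp only [alS, dif_pos (show i.1 + 1 ≤ 2 * m by omega), h]
  simp

lemma X_inr_eq_beS (v : Σ p : Fin l, Fin (n p / 2)) :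
    X (Sum.inr v) = beS m l n v.1 (v.2 + 1) := by
  have := v.2.2
  have h : min (v.2.1 + 1) (n v.1 - (v.2.1 + 1)) = v.2.1 + 1 := by omega
  simp only [beS, dif_pos (show v.2.1 + 1 ≤ n v.1 by omega), h]
  simp

variable (m l n) in
/-- The generating polynomial `∑ α_{2i} X^i`. -/
noncomputable def alEven :
    Polynomial (MvPolynomial (Fin m ⊕ Σ p : Fin l, Fin (n p / 2)) (ZMod 2)) :=
  ∑ i ∈ Finset.range (m + 1), Polynomial.C (alS m l n (2 * i)) * Polynomial.X ^ i

variable (m l n) in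
/-- The generating polynomial `∑ β_i^{(p)} X^i`. -/
noncomputable def bePoly (p : Fin l) :
    Polynomial (MvPolynomial (Fin m ⊕ Σ p : Fin l, Fin (n p / 2)) (ZMod 2)) :=
  ∑ i ∈ Finset.range (n p + 1), Polynomial.C (beS m l n p i) * Polynomial.X ^ i

lemma coeff_alEven (i : ℕ) : (alEven m l n).coeff i = alS m l n (2 * i) := by
  simp only [alEven, Polynomial.finsetSum_coeff, Polynomial.coeff_C_mul_X_pow,
    Finset.sum_ite_eq, Finset.mem_range]
  split_ifs with h
  · rfl
  · rw [alS, dif_neg (by omega)]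

lemma coeff_bePoly (p : Fin l) (i : ℕ) : (bePoly m l n p).coeff i = beS m l n p i := by
  simp only [bePoly, Polynomial.finsetSum_coeff, Polynomial.coeff_C_mul_X_pow,
    Finset.sum_ite_eq, Finset.mem_range]
  split_ifs with h
  · rfl
  · rw [beS, dif_neg (by omega)]

lemma isPal_alEven : Polynomial.IsPal m (alEven m l n) := by
  refine Polynomial.isPal_of_coeff
    (Polynomial.natDegree_sum_le_of_forall_le _ _ fun i hi => ?_) fun i hi => ?_
  · exact (Polynomial.natDegree_C_mul_X_pow_le _ _).trans
      (Nat.lt_succ_iff.1 (Finset.mem_range.1 hi))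
  · rw [coeff_alEven, coeff_alEven, Nat.mul_sub, alS_two_mul_sub (by omega)]

lemma isPal_bePoly (p : Fin l) : Polynomial.IsPal (n p) (bePoly m l n p) := by
  refine Polynomial.isPal_of_coeff
    (Polynomial.natDegree_sum_le_of_forall_le _ _ fun i hi => ?_) fun i hi => ?_
  · exact (Polynomial.natDegree_C_mul_X_pow_le _ _).trans
      (Nat.lt_succ_iff.1 (Finset.mem_range.1 hi))
  · rw [coeff_bePoly, coeff_bePoly, beS_sub hi]

lemma muS_eq_coeff (j : ℕ) : muS m l n j = (∏ p, bePoly m l n p).coeff j := by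
  rw [Polynomial.coeff_prod_eq_sum_piFinset]
  simp only [muS, coeff_bePoly]

lemma muS_zero : muS m l n 0 = 1 := by
  rw [muS_eq_coeff, Polynomial.coeff_zero_prod]
  exact Finset.prod_eq_one fun p _ => by rw [coeff_bePoly, beS_zero]

variable (m l n) in
lemma two_eq_zero_mvPolynomial :
    (2 : MvPolynomial (Fin m ⊕ Σ p : Fin l, Fin (n p / 2)) (ZMod 2)) = 0 := by
  rw [← map_ofNat C, show (OfNat.ofNat 2 : ZMod 2) = 0 from rfl, C_0]

lemma nuS_two_mul (k : ℕ) :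
    nuS m l n (2 * k) = (alEven m l n * ∏ p, bePoly m l n p +
      (1 + Polynomial.X) ^ (m + ∑ p, n p)).coeff k := by
  rw [nuS, Polynomial.coeff_add, Polynomial.coeff_one_add_X_pow,
    natCast_choose_two_mul_two_mul (two_eq_zero_mvPolynomial m l n), mul_comm (alEven m l n),
    Polynomial.coeff_mul, Finset.Nat.sum_antidiagonal_eq_sum_range_succ_mk,
    Nat.mul_div_cancel_left k two_pos, add_left_inj]
  refine Finset.sum_congr rfl fun i _ => ?_
  rw [muS_eq_coeff, coeff_alEven, Nat.mul_sub, mul_comm]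

lemma nuS_two_mul_add_one (k : ℕ) :
    nuS m l n (2 * k + 1) = alS m l n (2 * k + 1) +
      ∑ i ∈ Finset.range k, alS m l n (2 * (k - (i + 1)) + 1) * muS m l n (i + 1) := by
  rw [nuS, natCast_choose_two_mul_two_mul_add_one (two_eq_zero_mvPolynomial m l n), add_zero,
    show (2 * k + 1) / 2 = k by omega, Finset.sum_range_succ', muS_zero, mul_one, mul_zero, Nat.sub_zero, add_comm,
    add_right_inj]
  refine Finset.sum_congr rfl fun i hi => ?_
  have := Finset.mem_range.1 hi
  rw [show 2 * k + 1 - 2 * (i + 1) = 2 * (k - (i + 1)) + 1 by omega]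

variable {T : Type*} [CommRing T]

lemma ringHom_mvPolynomial_ext
    {f g : MvPolynomial (Fin m ⊕ Σ p : Fin l, Fin (n p / 2)) (ZMod 2) →+* T}
    (h0 : (alEven m l n).map f = (alEven m l n).map g)
    (h : ∀ p, (bePoly m l n p).map f = (bePoly m l n p).map g)
    (h1 : ∀ j, 2 * j + 1 ≤ m → f (alS m l n (2 * j + 1)) = g (alS m l n (2 * j + 1))) :
    f = g := by
  refine MvPolynomial.ringHom_ext (fun r => ?_) ?_
  · exact RingHom.congr_fun (Subsingleton.elim (f.comp C) (g.comp C)) r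
  · rintro (i | v)
    · rw [X_inl_eq_alS]
      obtain ⟨j, hj | hj⟩ := Nat.even_or_odd' (i.1 + 1)
      · rw [hj, ← coeff_alEven, ← Polynomial.coeff_map, h0, Polynomial.coeff_map]
      · rw [hj]
        exact h1 j (by omega)
    · rw [X_inr_eq_beS, ← coeff_bePoly, ← Polynomial.coeff_map, h, Polynomial.coeff_map]

lemma exists_ringHom_mvPolynomial (h2 : (2 : T) = 0) {F₀ : Polynomial T}
    (hF₀ : Polynomial.IsPal m F₀) (hF₀0 : F₀.coeff 0 = 1) {F : Fin l → Polynomial T}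
    (hF : ∀ p, Polynomial.IsPal (n p) (F p)) (hF0 : ∀ p, (F p).coeff 0 = 1) (a : ℕ → T) :
    ∃ φ : MvPolynomial (Fin m ⊕ Σ p : Fin l, Fin (n p / 2)) (ZMod 2) →+* T,
      (alEven m l n).map φ = F₀ ∧ (∀ p, (bePoly m l n p).map φ = F p) ∧
      ∀ j, 2 * j + 1 ≤ m → φ (alS m l n (2 * j + 1)) = a j := by
  have := ringChar.charP T
  have hdvd : ringChar T ∣ 2 := (ringChar.spec T 2).1 (by exact_mod_cast h2)
  set φ : MvPolynomial (Fin m ⊕ Σ p : Fin l, Fin (n p / 2)) (ZMod 2) →+* T :=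
    eval₂Hom (ZMod.castHom hdvd T) (Sum.elim
      (fun i => if (i.1 + 1) % 2 = 0 then F₀.coeff ((i.1 + 1) / 2) else a (i.1 / 2))
      (fun v => (F v.1).coeff (v.2.1 + 1))) with hφ
  have hα : ∀ i : ℕ, 0 < i → i ≤ m →
      φ (alS m l n i) = if i % 2 = 0 then F₀.coeff (i / 2) else a (i / 2) := by
    intro i hi him
    have h := X_inl_eq_alS (n := n) (⟨i - 1, by omega⟩ : Fin m)
    simp only [Nat.sub_add_cancel hi] at h
    rw [← h, hφ, coe_eval₂Hom, eval₂_X, Sum.elim_inl]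
    simp only [Nat.sub_add_cancel hi]
    split_ifs
    · rfl
    · congr 1
      omega
  have hβ : ∀ p, ∀ i ≤ n p / 2, φ (beS m l n p i) = (F p).coeff i := by
    rintro p (_ | i) hi
    · rw [beS_zero, map_one, hF0]
    · have h := X_inr_eq_beS (m := m) (n := n) ⟨p, ⟨i, hi⟩⟩
      rw [← h, hφ, coe_eval₂Hom, eval₂_X, Sum.elim_inr]
  refine ⟨φ, ?_, fun p => ?_, fun j hj => ?_⟩
  · refine (isPal_alEven.map φ).ext hF₀ fun i hi => ?_
    rw [Polynomial.coeff_map, coeff_alEven]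
    rcases i.eq_zero_or_pos with rfl | h
    · rw [alS_zero, map_one, hF₀0]
    · rw [hα _ (by omega) (by omega), if_pos (by omega), Nat.mul_div_cancel_left i two_pos]
  · refine ((isPal_bePoly p).map φ).ext (hF p) fun i hi => ?_
    rw [Polynomial.coeff_map, coeff_bePoly, hβ p i hi]
  · rw [hα _ (by omega) hj, if_neg (by omega)]
    congr 1
    omega

lemma map_nuS_two_mul (h2 : (2 : T) = 0)
    (φ : MvPolynomial (Fin m ⊕ Σ p : Fin l, Fin (n p / 2)) (ZMod 2) →+* T)
    {r h : ℕ} (hrh : m + ∑ p, n p = r + h) {Q : Polynomial T}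
    (hQ : (alEven m l n).map φ * ∏ p, (bePoly m l n p).map φ = (1 + Polynomial.X) ^ r * Q)
    (k : ℕ) :
    φ (nuS m l n (2 * k)) =
      ((1 + Polynomial.X) ^ r * (Q - (1 + Polynomial.X) ^ h)).coeff k := by
  have h2' : (2 : Polynomial T) = 0 := by rw [← Polynomial.C_ofNat, h2, Polynomial.C_0]
  rw [nuS_two_mul, ← Polynomial.coeff_map, Polynomial.map_add, Polynomial.map_mul,
    Polynomial.map_prod, hQ, hrh]
  congr 1
  simp only [Polynomial.map_pow, Polynomial.map_add, Polynomial.map_one, Polynomial.map_X]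
  linear_combination (1 + Polynomial.X) ^ (r + h) * h2'

lemma map_nuS_two_mul_add_one_sub_mem
    (φ : MvPolynomial (Fin m ⊕ Σ p : Fin l, Fin (n p / 2)) (ZMod 2) →+* T) (k : ℕ) :
    φ (nuS m l n (2 * k + 1)) - φ (alS m l n (2 * k + 1)) ∈
      Ideal.ofList ((List.range k).map fun j => φ (alS m l n (2 * j + 1))) := by
  rw [nuS_two_mul_add_one, map_add, add_sub_cancel_left, map_sum]
  refine Ideal.sum_mem _ fun i hi => ?_
  have := Finset.mem_range.1 hi
  rw [map_mul]
  exact Ideal.mul_mem_right _ _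
    (mem_ofList_map_range (g := fun j => φ (alS m l n (2 * j + 1)))
      (by omega : k - (i + 1) < k))

lemma coeff_one_add_X_pow_mul_sub_mem {D : Polynomial T} (hD : D.coeff 0 = 0) (r i : ℕ) :
    ((1 + Polynomial.X) ^ r * D).coeff (i + 1) - D.coeff (i + 1) ∈
      Ideal.ofList ((List.range i).map fun j => D.coeff (j + 1)) := by
  rw [Polynomial.coeff_mul, Finset.Nat.sum_antidiagonal_succ]
  simp only [Polynomial.coeff_one_add_X_pow, Nat.choose_zero_right, Nat.cast_one, one_mul,
    add_sub_cancel_left]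
  refine Ideal.sum_mem _ fun x hx => ?_
  have := Finset.HasAntidiagonal.mem_antidiagonal.1 hx
  rcases hx2 : x.2 with _ | j
  · rw [hD, mul_zero]
    exact Ideal.zero_mem _
  · exact Ideal.mul_mem_left _ _ (mem_ofList_map_range (g := fun j => D.coeff (j + 1)) (by omega))

lemma Polynomial.isPal_one_add_X_pow_mul_prod_quad (d : ℕ) (y : Fin (d / 2) → T) :
    Polynomial.IsPal d ((1 + Polynomial.X) ^ (d % 2) * ∏ j, Polynomial.quad (y j)) := by
  have h := (Polynomial.IsPal.one_add_X_pow (R := T) (d % 2)).mul (Polynomial.IsPal.prod_quad y)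
  rwa [Nat.mod_add_div] at h

lemma Polynomial.coeff_zero_one_add_X_pow_mul_prod_quad (r : ℕ) {k : ℕ} (y : Fin k → T) :
    ((1 + Polynomial.X) ^ r * ∏ j, Polynomial.quad (y j)).coeff 0 = 1 := by
  rw [Polynomial.mul_coeff_zero, Polynomial.coeff_zero_prod_quad, Polynomial.coeff_one_add_X_pow]
  simp

variable (m l n) in
/-- Over a suitable extension of `S`, the generating polynomials split into quadratic factors. -/
lemma exists_hasRetraction_split :
    ∃ (U : Type) (_ : CommRing U)
      (f : MvPolynomial (Fin m ⊕ Σ p : Fin l, Fin (n p / 2)) (ZMod 2) →+* U)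
      (y : (Fin (m / 2) ⊕ Σ p : Fin l, Fin (n p / 2)) → U), HasRetraction f ∧
      (alEven m l n).map f =
        (1 + Polynomial.X) ^ (m % 2) * ∏ j, Polynomial.quad (y (Sum.inl j)) ∧
      ∀ p, (bePoly m l n p).map f =
        (1 + Polynomial.X) ^ (n p % 2) * ∏ j, Polynomial.quad (y (Sum.inr ⟨p, j⟩)) := by
  obtain ⟨V, _, f, hf, hV⟩ := Polynomial.exists_forall_eq_one_add_X_pow_mul_prod_quad
    Finset.univ (two_eq_zero_mvPolynomial m l n) (isPal_bePoly (m := m) (n := n))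
    (fun p => by rw [coeff_bePoly, beS_zero])
  choose y hy using fun p => hV p (Finset.mem_univ p)
  obtain ⟨U, _, g, x, hg, hx⟩ := Polynomial.exists_eq_one_add_X_pow_mul_prod_quad
    (by rw [← map_ofNat f, two_eq_zero_mvPolynomial, map_zero])
    ((isPal_alEven (m := m) (n := n)).map f)
    (by rw [Polynomial.coeff_map, coeff_alEven, mul_zero, alS_zero, map_one])
  refine ⟨U, inferInstance, g.comp f, Sum.elim x fun v => g (y v.1 v.2), hg.comp hf, ?_,
    fun p => ?_⟩
  · rw [← Polynomial.map_map, hx]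
    rfl
  · rw [← Polynomial.map_map, hy, Polynomial.map_mul, Polynomial.map_prod]
    simp [Polynomial.map_quad]

variable (m l n) in
theorem isRegularSeq_nuS_even_append_odd :
    IsRegularSeq
      ((List.range (m / 2 + ∑ p, n p / 2)).map (fun i => nuS m l n (2 * (i + 1))) ++
        (List.range ((m + 1) / 2)).map fun i => nuS m l n (2 * i + 1)) := by
  set h := m / 2 + ∑ p, n p / 2 with hh
  obtain ⟨B, _, z, h2B, hB, hz⟩ := Polynomial.exists_universal_regMod_ofFn ((m + 1) / 2)
  obtain ⟨T, _, ι, x, hT, hreg⟩ := Polynomial.exists_universal_regMod h B h2B _ hz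
    (fun i => ((1 + Polynomial.X) ^ (2 * h) : Polynomial B).coeff i)
    (by rw [Polynomial.coeff_one_add_X_pow]; simp)
  have h2T : (2 : T) = 0 := by rw [← map_ofNat ι, h2B, map_zero]
  let e : (Fin (m / 2) ⊕ Σ p : Fin l, Fin (n p / 2)) ≃ Fin h :=
    Fintype.equivFinOfCardEq (by simp [hh])
  set a : ℕ → T := fun j => if hj : j < (m + 1) / 2 then ι (z ⟨j, hj⟩) else 0 with ha
  obtain ⟨φ, hφ0, hφ, hφ1⟩ := exists_ringHom_mvPolynomial (m := m) (n := n) h2T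
    (Polynomial.isPal_one_add_X_pow_mul_prod_quad m fun j => x (e (Sum.inl j)))
    (Polynomial.coeff_zero_one_add_X_pow_mul_prod_quad _ _)
    (fun p => Polynomial.isPal_one_add_X_pow_mul_prod_quad (n p)
      fun j => x (e (Sum.inr ⟨p, j⟩)))
    (fun p => Polynomial.coeff_zero_one_add_X_pow_mul_prod_quad _ _) a
  have hofFn : (List.ofFn z).map ι =
      (List.range ((m + 1) / 2)).map fun j => φ (alS m l n (2 * j + 1)) := by
    refine List.ext_getElem (by simp) fun j h1 h3 => ?_
    have hj : j < (m + 1) / 2 := by simpa using h1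
    simp [hφ1 j (by omega), ha, hj]
  have hφreg : RegMod ⊥
      (((List.range h).map (fun i => nuS m l n (2 * (i + 1))) ++
        (List.range ((m + 1) / 2)).map fun i => nuS m l n (2 * i + 1)).map φ) := by
    rw [List.map_append, List.map_map, List.map_map]
    have hQ : (alEven m l n).map φ * ∏ p, (bePoly m l n p).map φ =
        (1 + Polynomial.X) ^ (m % 2 + ∑ p, n p % 2) * ∏ j, Polynomial.quad (x j) := by
      rw [hφ0, ← e.prod_comp, Fintype.prod_sum_type, Fintype.prod_sigma, pow_add,
        ← Finset.prod_pow_eq_pow_sum]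
      simp only [hφ, Finset.prod_mul_distrib]
      ring
    have hrh : m + ∑ p, n p = m % 2 + ∑ p, n p % 2 + 2 * h := by
      have : ∑ p, n p = ∑ p, n p % 2 + 2 * ∑ p, n p / 2 := by
        rw [Finset.mul_sum, ← Finset.sum_add_distrib]
        exact Finset.sum_congr rfl fun p _ => (Nat.mod_add_div _ _).symm
      omega
    refine regMod_map_range_append
      (g := fun i => (∏ j, Polynomial.quad (x j) -
        (1 + Polynomial.X) ^ (2 * h) : Polynomial T).coeff (i + 1)) (fun i _ => ?_) ?_
    · rw [Function.comp_apply, map_nuS_two_mul h2T φ hrh hQ]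
      refine Ideal.mem_sup_right (coeff_one_add_X_pow_mul_sub_mem ?_ _ i)
      rw [Polynomial.coeff_sub, Polynomial.coeff_zero_prod_quad, Polynomial.coeff_one_add_X_pow]
      simp
    · have hcoeff (i : ℕ) : (∏ j, Polynomial.quad (x j) -
          (1 + Polynomial.X) ^ (2 * h) : Polynomial T).coeff (i + 1) =
          (∏ j, Polynomial.quad (x j)).coeff (i + 1) -
            ι (((1 + Polynomial.X) ^ (2 * h) : Polynomial B).coeff (i + 1)) := by
        rw [Polynomial.coeff_sub, ← Polynomial.coeff_map]
        simp
      rw [hofFn, regMod_append] at hreg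
      simp only [hcoeff]
      rw [regMod_append]
      refine ⟨hreg.1, ?_⟩
      rw [← List.append_nil (List.map _ (List.range ((m + 1) / 2)))]
      refine regMod_map_range_append
        (fun k _ => Ideal.mem_sup_right (map_nuS_two_mul_add_one_sub_mem φ k)) ?_
      rw [List.append_nil]
      exact hreg.2
  obtain ⟨U, _, f, y, hf, hy0, hy⟩ := exists_hasRetraction_split m l n
  obtain ⟨ψ₀, hψ₀⟩ := hB U (by rw [← map_ofNat f, two_eq_zero_mvPolynomial, map_zero])
    fun j => f (alS m l n (2 * j + 1))
  obtain ⟨ψ, hψ, hψx⟩ := hT U ψ₀ fun j => y (e.symm j)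
  have hcomp : ψ.comp φ = f := by
    refine ringHom_mvPolynomial_ext ?_ (fun p => ?_) fun j hj => ?_
    · rw [← Polynomial.map_map, hφ0, hy0, Polynomial.map_mul, Polynomial.map_prod]
      simp [Polynomial.map_quad, hψx]
    · rw [← Polynomial.map_map, hφ, hy, Polynomial.map_mul, Polynomial.map_prod]
      simp [Polynomial.map_quad, hψx]
    · have hj' : j < (m + 1) / 2 := by omega
      rw [RingHom.comp_apply, hφ1 j hj]
      simp only [ha, dif_pos hj']
      rw [← RingHom.comp_apply, hψ, hψ₀]
  exact HasRetraction.isRegularSeq (φ := φ) (ψ := ψ) (by rwa [hcomp]) hφreg.isRegularSeq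

end Indeterminates

lemma filter_odd_range_perm (m : ℕ) :
    ((List.range (m + 1)).filter fun i => i % 2 == 1).Perm
      ((List.range ((m + 1) / 2)).map fun i => 2 * i + 1) := by
  refine (List.perm_ext_iff_of_nodup (List.nodup_range.filter _)
    (List.nodup_range.map fun a b h => by simpa using h)).2 fun i => ?_
  simp only [List.mem_filter, List.mem_range, List.mem_map, beq_iff_eq]
  exact ⟨fun h => ⟨i / 2, by omega, by omega⟩, by rintro ⟨j, h, rfl⟩; omega⟩

lemma filter_even_range_perm (h : ℕ) :
    ((List.range (2 * h + 1)).filter fun i => decide (i % 2 = 0 ∧ 2 ≤ i)).Perm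
      ((List.range h).map fun i => 2 * (i + 1)) := by
  refine (List.perm_ext_iff_of_nodup (List.nodup_range.filter _)
    (List.nodup_range.map fun a b h => by simpa using h)).2 fun i => ?_
  simp only [List.mem_filter, List.mem_range, List.mem_map, decide_eq_true_eq]
  exact ⟨fun h => ⟨i / 2 - 1, by omega, by omega⟩, by rintro ⟨j, h, rfl⟩; omega⟩

/-- The elements of `A₁ ∪ A₂`, where `A₁ = {ν_i : 1 ≤ i ≤ m, i odd}` and
`A₂ = {ν_i : 2 ≤ i ≤ 2h', i even}` with `h' = ⌊m/2⌋ + ⌊n₁/2⌋ + ⋯ + ⌊n_l/2⌋`, form an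
`S`-regular sequence in some order. -/
theorem stmt_15 (m l : ℕ) (hm : 1 ≤ m) (hl : 1 ≤ l) (n : Fin l → ℕ) (hn : ∀ p, 1 ≤ n p) :
    ∃ l' : List (MvPolynomial (Fin m ⊕ Σ p : Fin l, Fin (n p / 2)) (ZMod 2)),
      l'.Perm
        ((((List.range (m + 1)).filter (fun i => i % 2 == 1)).map (nuS m l n)) ++
          (((List.range (2 * (m / 2 + ∑ p, n p / 2) + 1)).filter
              (fun i => decide (i % 2 = 0 ∧ 2 ≤ i))).map (nuS m l n))) ∧
      IsRegularSeq l' := by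
  refine ⟨_, ?_, isRegularSeq_nuS_even_append_odd m l n⟩
  refine List.perm_append_comm.trans (List.Perm.append ?_ ?_)
  · simpa [Function.comp_def] using ((filter_odd_range_perm m).map (nuS m l n)).symm
  · simpa [Function.comp_def] using ((filter_even_range_perm _).map (nuS m l n)).symm
end
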